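/- arXiv:1607.02079 — 2 statements merged into one kernel-verified Lean document; each statement's English description precedes it below -/
import Mathlib

section
/- Let G be a non-abelian limit group, and let U be a normal subgroup of G of prime index p. Then rk_Q(U) > rk_Q(G). -/
open scoped TensorProduct

/-- A group is fully residually free if every finite subset is mapped injectively
by some homomorphism to a free group. -/
def FullyResiduallyFree (G : Type*) [Group G] : Prop :=
  ∀ T : Finset G, ∃ (α : Type) (f : G →* FreeGroup α), Set.InjOn f T

/-- The rational rank `rk_Q(G) = dim_Q (G^ab ⊗_Z Q)`. -/
noncomputable def rkQ (G : Type*) [Group G] : ℕ :=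
  Module.finrank ℚ (ℚ ⊗[ℤ] Additive (Abelianization G))

/-- The minimal number of generators of a group. -/
noncomputable def d (G : Type*) [Group G] : ℕ :=
  sInf {n | ∃ S : Finset G, S.card = n ∧ Subgroup.closure (S : Set G) = ⊤}


namespace LG

theorem pow_ell {R : Type*} [CommRing R] {S : Type*} [Ring S] [Algebra R S] (l N : ℕ) (hl : l.Prime)
    (h0 : ((l ^ N : ℕ) : S) = 0) (n : S) (K : ℕ) (hn : n ^ K = 0) : ∃ M, (1 + n) ^ (l ^ M) = 1 := by
  have hK : K ≤ l ^ K := (Nat.lt_pow_self hl.one_lt).le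
  have hn' : n ^ (l ^ K) = 0 := pow_eq_zero_of_le hK hn
  have := Fact.mk hl
  have h1 : ((l : ℕ) : Polynomial ℤ) ∣ (1 + Polynomial.X) ^ (l ^ K) - (1 + Polynomial.X ^ (l ^ K)) := by
    have := add_pow_prime_pow_eq hl (1 : Polynomial ℤ) Polynomial.X K
    rw [this]
    rw [one_pow, add_sub_cancel_left, mul_assoc, mul_assoc]
    exact dvd_mul_right _ _
  have h2 := dvd_sub_pow_of_dvd_sub h1 N
  obtain ⟨q, hq⟩ := h2
  have h3 := congrArg (Polynomial.aeval n) hq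
  simp only [map_sub, map_pow, map_add, map_one, Polynomial.aeval_X, map_mul, map_natCast, hn', add_zero,
    one_pow] at h3
  refine ⟨K + N, ?_⟩
  rw [pow_add, pow_mul]
  rw [pow_succ, ← Nat.cast_pow, h0, zero_mul, zero_mul] at h3
  exact sub_eq_zero.mp h3

/-- unitriangular -/
def UT {k : ℕ} {R : Type*} [CommRing R] (M : Matrix (Fin k) (Fin k) R) : Prop :=
  ∀ i j, j ≤ i → M i j = if i = j then 1 else 0

theorem UT.mul {k : ℕ} {R : Type*} [CommRing R] {M N : Matrix (Fin k) (Fin k) R} (hM : UT M) (hN : UT N) :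
    UT (M * N) := by
  intro i j hij
  rw [Matrix.mul_apply]
  have : ∀ s, M i s * N s j = if s = i then (if i = j then 1 else 0) else 0 := by
    intro s
    by_cases h : s ≤ i
    · rw [hM i s h]
      by_cases h' : s = i
      · subst h'; simp [hN s j hij]
      · rw [if_neg (Ne.symm h'), if_neg h']; simp
    · have : s ≠ i := by rintro rfl; exact h le_rfl
      rw [if_neg this, hN s j (by omega), if_neg (by omega), mul_zero]
  simp [this]

theorem UT.nilp {k : ℕ} {R : Type*} [CommRing R] {M : Matrix (Fin k) (Fin k) R} (hM : UT M) :
    (M - 1) ^ k = 0 := by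
  have h : M.charpoly = (Polynomial.X - 1) ^ k := by
    rw [Matrix.charpoly_of_isUpperTriangular]
    · rw [Finset.prod_congr rfl (g := fun _ => Polynomial.X - 1)]
      · simp
      · intro i _
        rw [hM i i le_rfl]; simp
    · intro i j hij
      rw [hM i j (le_of_lt hij), if_neg]
      rintro rfl; exact lt_irrefl _ hij
  have := Matrix.aeval_self_charpoly M
  rw [h] at this
  simpa using this

theorem syll {β : Type*} (w : FreeGroup β) : ∃ L : List (β × ℤ), (L.IsChain (fun a b => a.1 ≠ b.1)) ∧
    (∀ a ∈ L, a.2 ≠ 0) ∧ w = (L.map (fun a => FreeGroup.of a.1 ^ a.2)).prod := by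
  classical
  have key : ∀ (b : β) (e : ℤ), ∀ w : FreeGroup β, (∃ L : List (β × ℤ), (L.IsChain (fun a b => a.1 ≠ b.1)) ∧
    (∀ a ∈ L, a.2 ≠ 0) ∧ w = (L.map (fun a => FreeGroup.of a.1 ^ a.2)).prod) →
    (∃ L : List (β × ℤ), (L.IsChain (fun a b => a.1 ≠ b.1)) ∧
    (∀ a ∈ L, a.2 ≠ 0) ∧ FreeGroup.of b ^ e * w = (L.map (fun a => FreeGroup.of a.1 ^ a.2)).prod) := by
    rintro b e w ⟨L, h1, h2, rfl⟩
    by_cases he : e = 0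
    · exact ⟨L, h1, h2, by simp [he]⟩
    cases L with
    | nil => exact ⟨[(b, e)], by simp, by simpa using he, by simp⟩
    | cons a L =>
      obtain ⟨c, f⟩ := a
      by_cases hc : b = c
      · subst hc
        by_cases hf : e + f = 0
        · refine ⟨L, ?_, fun a ha => h2 a (by simp [ha]), ?_⟩
          · exact h1.tail
          · simp only [List.map_cons, List.prod_cons]
            rw [← mul_assoc, ← zpow_add, hf]; simp
        · refine ⟨(b, e + f) :: L, ?_, ?_, ?_⟩
          · rw [List.isChain_cons] at h1 ⊢
            exact h1
          · intro a ha
            rcases List.mem_cons.mp ha with rfl | ha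
            · exact hf
            · exact h2 a (by simp [ha])
          · simp only [List.map_cons, List.prod_cons]
            rw [← mul_assoc, ← zpow_add]
      · refine ⟨(b, e) :: (c, f) :: L, ?_, ?_, ?_⟩
        · exact List.IsChain.cons_cons hc h1
        · intro a ha
          rcases List.mem_cons.mp ha with rfl | ha
          · exact he
          · exact h2 a ha
        · simp
  induction w using FreeGroup.induction_on with
  | C1 => exact ⟨[], by simp, by simp, by simp⟩
  | of x => simpa using key x 1 1 ⟨[], by simp, by simp, by simp⟩
  | inv_of x _ => simpa using key x (-1) 1 ⟨[], by simp, by simp, by simp⟩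
  | mul x y hx hy =>
    obtain ⟨L, -, -, rfl⟩ := hx
    induction L with
    | nil => simpa using hy
    | cons a L ih =>
      have := key a.1 a.2 _ ih
      simpa [mul_assoc] using this

/-- step matrix -/
def Y {β : Type*} [DecidableEq β] (R : Type*) [CommRing R] (L : List (β × ℤ)) (b : β) :
    Matrix (Fin (L.length + 1)) (Fin (L.length + 1)) R :=
  Matrix.of fun s t => if t.val = s.val + 1 ∧ (L.map Prod.fst)[s.val]? = some b then 1 else 0

theorem Y_sq {β : Type*} [DecidableEq β] (R : Type*) [CommRing R] (L : List (β × ℤ))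
    (hL : L.IsChain (fun a b => a.1 ≠ b.1)) (b : β) : Y R L b * Y R L b = 0 := by
  ext s t
  rw [Matrix.mul_apply]
  apply Finset.sum_eq_zero
  intro u _
  simp only [Y, Matrix.of_apply]
  by_contra h
  have h1 := left_ne_zero_of_mul h
  have h2 := right_ne_zero_of_mul h
  simp only [ne_eq, ite_eq_right_iff, Classical.not_imp] at h1 h2
  obtain ⟨⟨h1, h1'⟩, -⟩ := h1
  obtain ⟨⟨h2, h2'⟩, -⟩ := h2
  have hh := List.isChain_iff_getElem.mp hL
  rw [h1] at h2'
  have hb : s.val + 1 < L.length := by omega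
  have := hh s.val hb
  rw [List.getElem?_eq_getElem (by simp; omega)] at h1' h2'
  simp at h1' h2'
  exact this (h1'.trans h2'.symm)

/-- unit -/
def uY {β : Type*} [DecidableEq β] (R : Type*) [CommRing R] (L : List (β × ℤ))
    (hL : L.IsChain (fun a b => a.1 ≠ b.1)) (b : β) :
    (Matrix (Fin (L.length + 1)) (Fin (L.length + 1)) R)ˣ where
  val := 1 + Y R L b
  inv := 1 - Y R L b
  val_inv := by
    have := Y_sq R L hL b
    noncomm_ring
    simp [this]
  inv_val := by
    have := Y_sq R L hL b
    noncomm_ring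
    simp [this]

theorem uY_zpow {β : Type*} [DecidableEq β] (R : Type*) [CommRing R] (L : List (β × ℤ))
    (hL : L.IsChain (fun a b => a.1 ≠ b.1)) (b : β) (e : ℤ) :
    ((uY R L hL b ^ e : (Matrix (Fin (L.length + 1)) (Fin (L.length + 1)) R)ˣ) :
      Matrix (Fin (L.length + 1)) (Fin (L.length + 1)) R) = 1 + (e : R) • Y R L b := by
  have hs := Y_sq R L hL b
  induction e with
  | zero => simp
  | succ n ih =>
    rw [zpow_add_one, Units.val_mul, ih]
    show _ * (1 + Y R L b) = _
    simp [mul_add, add_mul, hs, add_smul]; abel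
  | pred n ih =>
    rw [zpow_sub_one, Units.val_mul, ih]
    show _ * (1 - Y R L b) = _
    simp [mul_sub, add_mul, hs, sub_smul]; abel

theorem col {β : Type*} [DecidableEq β] (R : Type*) [CommRing R] (L : List (β × ℤ))
    (hL : L.IsChain (fun a b => a.1 ≠ b.1)) (L2 : List (β × ℤ)) : ∀ L1 : List (β × ℤ), L = L1 ++ L2 →
    ∀ t : Fin (L.length + 1), (t.val < L1.length →
      (((L2.map (fun a => uY R L hL a.1 ^ a.2)).prod : (Matrix (Fin (L.length + 1)) (Fin (L.length + 1)) R)ˣ) :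
      Matrix (Fin (L.length + 1)) (Fin (L.length + 1)) R) t (Fin.last _) = 0) ∧ (t.val = L1.length →
      (((L2.map (fun a => uY R L hL a.1 ^ a.2)).prod : (Matrix (Fin (L.length + 1)) (Fin (L.length + 1)) R)ˣ) :
      Matrix (Fin (L.length + 1)) (Fin (L.length + 1)) R) t (Fin.last _) =
       (((L2.map Prod.snd).prod : ℤ) : R)) := by
  induction L2 with
  | nil =>
    intro L1 h t
    have hlen : L.length = L1.length := by simp [h]
    constructor
    · intro ht
      simp only [List.map_nil, List.prod_nil, Units.val_one]
      rw [Matrix.one_apply_ne]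
      intro h'; rw [h'] at ht; simp at ht; omega
    · intro ht
      have : t = Fin.last _ := by ext; simp; omega
      simp [this]
  | cons a L2 ih =>
    intro L1 h t
    have hlen : L.length = L1.length + L2.length + 1 := by simp [h]; omega
    have ih := ih (L1 ++ [a]) (by simp [h])
    simp only [List.map_cons, List.prod_cons, Units.val_mul, uY_zpow]
    set Q := (((L2.map (fun a => uY R L hL a.1 ^ a.2)).prod : (Matrix (Fin (L.length + 1)) (Fin (L.length + 1)) R)ˣ) :
      Matrix (Fin (L.length + 1)) (Fin (L.length + 1)) R)
    have hla : (L1 ++ [a]).length = L1.length + 1 := by simp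
    rw [add_mul, one_mul, smul_mul_assoc, Matrix.add_apply, Matrix.smul_apply, Matrix.mul_apply]
    constructor
    · intro ht
      rw [(ih t).1 (by omega), zero_add, Finset.sum_eq_zero, smul_zero]
      intro u _
      simp only [Y, Matrix.of_apply]
      split_ifs with hu
      · rw [(ih u).1 (by omega), mul_zero]
      · rw [zero_mul]
    · intro ht
      rw [(ih t).1 (by omega), zero_add]
      have ht1 : t.val + 1 < L.length + 1 := by omega
      rw [Finset.sum_eq_single (⟨t.val + 1, ht1⟩ : Fin (L.length + 1))]
      · rw [(ih ⟨t.val + 1, ht1⟩).2 (by simp; omega)]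
        simp [Y, ht, h]
      · intro u _ hu
        simp only [Y, Matrix.of_apply]
        rw [if_neg, zero_mul]
        rintro ⟨h1, -⟩
        exact hu (Fin.ext h1)
      · simp

theorem UT_uY {β : Type*} [DecidableEq β] (R : Type*) [CommRing R] (L : List (β × ℤ))
    (hL : L.IsChain (fun a b => a.1 ≠ b.1)) (b : β) (e : ℤ) :
    UT ((uY R L hL b ^ e : (Matrix (Fin (L.length + 1)) (Fin (L.length + 1)) R)ˣ) :
      Matrix (Fin (L.length + 1)) (Fin (L.length + 1)) R) := by
  rw [uY_zpow]
  intro i j hij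
  rw [Matrix.add_apply, Matrix.smul_apply]
  have : Y R L b i j = 0 := by
    simp only [Y, Matrix.of_apply]
    rw [if_neg]
    rintro ⟨h1, -⟩
    have := Fin.le_def.mp hij
    omega
  rw [this]; simp [Matrix.one_apply]

theorem free_res1 {β : Type*} (l : ℕ) (hl : l.Prime) (w : FreeGroup β) (hw : w ≠ 1) :
    ∃ (P : Type) (_ : Group P) (_ : Finite P) (_ : IsPGroup l P) (ψ : FreeGroup β →* P), ψ w ≠ 1 := by
  classical
  obtain ⟨L, hL, hne, hwL⟩ := syll w
  set D : ℤ := (L.map Prod.snd).prod with hD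
  have hD0 : D ≠ 0 := by
    rw [hD]; apply List.prod_ne_zero
    intro h
    obtain ⟨a, ha, h0⟩ := List.mem_map.mp h
    exact hne a ha h0
  set N := D.natAbs with hN
  have : NeZero (l ^ N) := ⟨pow_ne_zero _ hl.ne_zero⟩
  set R := ZMod (l ^ N)
  let φ : FreeGroup β →* (Matrix (Fin (L.length + 1)) (Fin (L.length + 1)) R)ˣ :=
    FreeGroup.lift (uY R L hL)
  have hφ : ∀ g : FreeGroup β, UT (φ g : Matrix (Fin (L.length + 1)) (Fin (L.length + 1)) R) := by
    intro g
    obtain ⟨L', -, -, rfl⟩ := syll g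
    rw [map_list_prod, List.map_map]
    induction L' with
    | nil => intro i j _; simp [Matrix.one_apply]
    | cons a L' ih =>
      rw [List.map_cons, List.prod_cons, Units.val_mul]
      refine UT.mul ?_ ih
      simp only [Function.comp, map_zpow]
      rw [FreeGroup.lift_apply_of]
      exact UT_uY R L hL _ _
  refine ⟨φ.range, inferInstance, inferInstance, ?_, φ.rangeRestrict, ?_⟩
  · rintro ⟨_, g, rfl⟩
    obtain ⟨M, hM⟩ := pow_ell (R := R) (S := Matrix (Fin (L.length + 1)) (Fin (L.length + 1)) R) l N hl
      (by
        have : ((l ^ N : ℕ) : R) = 0 := ZMod.natCast_self _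
        rw [← map_natCast (algebraMap R _), this, map_zero])
      _ _ (hφ g).nilp
    refine ⟨M, ?_⟩
    ext1; ext1
    simpa using hM
  · intro h
    have h' : φ w = 1 := congrArg Subtype.val h
    have hc := (col R L hL L [] rfl 0).2 rfl
    have : (L.map (fun a => uY R L hL a.1 ^ a.2)).prod = φ w := by
      conv_rhs => rw [hwL]
      rw [map_list_prod, List.map_map]
      congr 1
      apply List.map_congr_left
      intro a _
      simp [φ]
    rw [this, h', ← hD] at hc
    by_cases hlen : L.length = 0
    · have : L = [] := List.length_eq_zero_iff.mp hlen
      apply hw; rw [hwL, this]; simp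
    · rw [Units.val_one, Matrix.one_apply_ne (by intro h; exact hlen (by simpa using (congrArg Fin.val h).symm))] at hc
      have h1 := (ZMod.intCast_zmod_eq_zero_iff_dvd D (l ^ N)).mp hc.symm
      have h2 := Int.natAbs_dvd_natAbs.mpr h1
      rw [Int.natAbs_natCast] at h2
      have h3 := Nat.le_of_dvd (by positivity) h2
      have h4 : N < l ^ N := Nat.lt_pow_self hl.one_lt
      omega

theorem free_res {β : Type*} (l : ℕ) (hl : l.Prime) (T : Finset (FreeGroup β)) :
    ∃ (P : Type) (_ : Group P) (_ : Finite P) (_ : IsPGroup l P) (ψ : FreeGroup β →* P),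
      ∀ w ∈ T, w ≠ 1 → ψ w ≠ 1 := by
  classical
  induction T using Finset.induction_on with
  | empty => exact ⟨Unit, inferInstance, inferInstance, fun g => ⟨0, rfl⟩, 1, by simp⟩
  | insert a s _ ih =>
    obtain ⟨P, iP, fP, hP, ψ, h⟩ := ih
    by_cases ha : a = 1
    · refine ⟨P, iP, fP, hP, ψ, ?_⟩
      intro w hw hw1
      rcases Finset.mem_insert.mp hw with rfl | hw
      · exact absurd ha hw1
      · exact h w hw hw1
    obtain ⟨P', iP', fP', hP', ψ', h'⟩ := free_res1 l hl a ha
    refine ⟨P × P', inferInstance, inferInstance, ?_, ψ.prod ψ', ?_⟩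
    · rintro ⟨x, y⟩
      obtain ⟨m, hm⟩ := hP x
      obtain ⟨m', hm'⟩ := hP' y
      refine ⟨m + m', ?_⟩
      ext
      · simp [pow_add, pow_mul, hm]
      · simp only [Prod.pow_mk, Prod.snd_one]
        rw [add_comm, pow_add, pow_mul, hm', one_pow]
    · intro w hw hw1 hc
      rcases Finset.mem_insert.mp hw with rfl | hw
      · exact h' (congrArg Prod.snd hc)
      · exact h w hw hw1 (congrArg Prod.fst hc)

end LG


namespace LG

theorem exists_R (η : ℝ) (hη : 0 < η) : ∃ R : ℕ, ∀ t : ℝ, 0 < t → t ≤ 1 →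
    (1 - t) ^ R ≤ η * (1 - Real.log t) := by
  set s := Real.exp (-(1 / η)) with hs
  have hs0 : 0 < s := Real.exp_pos _
  have hs1 : s < 1 := by rw [hs, Real.exp_lt_one_iff]; have : 0 < 1 / η := by positivity
                         linarith
  obtain ⟨R, hR⟩ := exists_pow_lt_of_lt_one hη (show 1 - s < 1 by linarith)
  refine ⟨R, fun t ht0 ht1 => ?_⟩
  have hlog : Real.log t ≤ 0 := Real.log_nonpos ht0.le ht1
  rcases lt_or_ge t s with h | h
  · have h1 : Real.log t ≤ -(1 / η) := by
      rw [← Real.log_exp (-(1 / η))]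
      exact Real.log_le_log ht0 h.le
    have h2 : η * (1 / η) = 1 := by field_simp
    have h3 : (1 - t) ^ R ≤ 1 := pow_le_one₀ (by linarith) (by linarith)
    nlinarith
  · have : (1 - t) ^ R ≤ (1 - s) ^ R := pow_le_pow_left₀ (by linarith) (by linarith) R
    nlinarith

theorem prod_nonzero_eig {n : Type*} [Fintype n] [DecidableEq n] (M : Matrix n n ℤ)
    (h : (M.map (Int.cast : ℤ → ℝ)).IsHermitian) :
    (1 : ℝ) ≤ |∏ i ∈ Finset.univ.filter (fun i => h.eigenvalues i ≠ 0), h.eigenvalues i| := by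
  have h1 := h.charpoly_eq
  have h2 : (M.map (Int.cast : ℤ → ℝ)).charpoly = M.charpoly.map (Int.castRingHom ℝ) :=
    Matrix.charpoly_map M (Int.castRingHom ℝ)
  rw [h2] at h1
  set Z := Finset.univ.filter (fun i => h.eigenvalues i ≠ 0)
  set Z' := Finset.univ.filter (fun i => ¬ h.eigenvalues i ≠ 0)
  rw [← Finset.prod_filter_mul_prod_filter_not Finset.univ (fun i => h.eigenvalues i ≠ 0)] at h1
  have h3 : ∏ i ∈ Z', (Polynomial.X - Polynomial.C ((h.eigenvalues i : ℝ) : ℝ)) = Polynomial.X ^ Z'.card := by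
    rw [Finset.prod_congr rfl (g := fun _ => Polynomial.X)]
    · simp
    · intro i hi
      have : h.eigenvalues i = 0 := by simpa [Z'] using hi
      simp [this]
  have h4 := congrArg (fun q => Polynomial.coeff q Z'.card) h1
  simp only [Polynomial.coeff_map] at h4
  erw [h3] at h4
  rw [Polynomial.coeff_mul_X_pow', if_pos le_rfl, Nat.sub_self, Polynomial.coeff_zero_prod] at h4
  have h5 : |∏ i ∈ Z, h.eigenvalues i| = |((M.charpoly.coeff Z'.card : ℤ) : ℝ)| := by
    rw [show ((M.charpoly.coeff Z'.card : ℤ) : ℝ) = _ from h4, Finset.abs_prod, Finset.abs_prod]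
    apply Finset.prod_congr rfl
    intro i _
    simp
  have h6 : (∏ i ∈ Z, h.eigenvalues i) ≠ 0 := by
    rw [Finset.prod_ne_zero_iff]
    intro i hi
    simpa [Z] using hi
  rw [h5]
  have h7 : M.charpoly.coeff Z'.card ≠ 0 := by
    intro h0
    rw [h0] at h5
    simp at h5
    exact h6 h5
  exact_mod_cast Int.one_le_abs h7

theorem trace_pow_eig {n : Type*} [Fintype n] [DecidableEq n] (A : Matrix n n ℝ)
    (h : A.IsHermitian) (L : ℝ) (R : ℕ) :
    ((L • (1 : Matrix n n ℝ) - A) ^ R).trace = ∑ i, (L - h.eigenvalues i) ^ R := by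
  have hs := h.spectral_theorem
  set U := h.eigenvectorUnitary
  have h1 : L • (1 : Matrix n n ℝ) - A =
      Unitary.conjStarAlgAut ℝ _ U (Matrix.diagonal (fun i => L - h.eigenvalues i)) := by
    have : Matrix.diagonal (fun i => L - h.eigenvalues i) =
      L • (1 : Matrix n n ℝ) - Matrix.diagonal (RCLike.ofReal ∘ h.eigenvalues) := by
      ext i j
      by_cases hij : i = j
      · subst hij; simp
      · simp [hij]
    rw [this, map_sub, ← hs, map_smul, map_one]
  rw [h1, ← map_pow, Unitary.conjStarAlgAut_apply, Matrix.trace_mul_comm, ← mul_assoc]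
  simp [Matrix.diagonal_pow, Matrix.trace_diagonal]

theorem eig_le {n : Type*} [Fintype n] [DecidableEq n] (A : Matrix n n ℝ)
    (h : A.IsHermitian) (L : ℝ) (hL : ∀ i, ∑ j, |A i j| ≤ L) (i : n) : h.eigenvalues i ≤ L := by
  have : Module.End.HasEigenvalue (Matrix.toLin' A) (h.eigenvalues i) := by
    rw [Module.End.hasEigenvalue_iff_mem_spectrum, Matrix.spectrum_toLin']
    exact h.eigenvalues_mem_spectrum_real i
  obtain ⟨k, hk⟩ := eigenvalue_mem_ball this
  rw [Metric.mem_closedBall, Real.dist_eq] at hk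
  have h2 := hL k
  rw [← Finset.add_sum_erase _ _ (Finset.mem_univ k)] at h2
  simp only [Real.norm_eq_abs] at hk
  have := le_abs_self (h.eigenvalues i - A k k)
  have := le_abs_self (A k k)
  linarith

/-- two-sided bound for the nullity -/
theorem luck {m n : Type*} [Fintype m] [Fintype n] [DecidableEq n] (J : Matrix m n ℤ) (L : ℕ) (hL1 : 1 ≤ L)
    (hL : ∀ i, ∑ j, |(J.transpose * J) i j| ≤ L) (η : ℝ) (hη : 0 < η) (R : ℕ)
    (hR : ∀ t : ℝ, 0 < t → t ≤ 1 → (1 - t) ^ R ≤ η * (1 - Real.log t)) :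
    ((Fintype.card n : ℝ) - (J.map (Int.cast : ℤ → ℝ)).rank) * (L : ℝ) ^ R ≤
      (((L : ℤ) • (1 : Matrix n n ℤ) - J.transpose * J) ^ R).trace ∧
    ((((L : ℤ) • (1 : Matrix n n ℤ) - J.transpose * J) ^ R).trace : ℝ) ≤
     ((Fintype.card n : ℝ) - (J.map (Int.cast : ℤ → ℝ)).rank + η * Fintype.card n * (1 + Real.log L)) * (L : ℝ) ^ R := by
  set M := J.transpose * J with hM
  set A := M.map (Int.cast : ℤ → ℝ) with hA
  have hAJ : A = (J.map (Int.cast : ℤ → ℝ)).transpose * (J.map (Int.cast : ℤ → ℝ)) := by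
    have := Matrix.map_mul (L := J.transpose) (M := J) (f := Int.castRingHom ℝ)
    rw [hA, hM]
    exact this
  have hps : A.PosSemidef := by
    have := Matrix.posSemidef_conjTranspose_mul_self (J.map (Int.cast : ℤ → ℝ))
    rwa [Matrix.conjTranspose_eq_transpose_of_trivial, ← hAJ] at this
  have hH : A.IsHermitian := hps.isHermitian
  have htr : ((((L : ℤ) • (1 : Matrix n n ℤ) - M) ^ R).trace : ℝ) = ∑ i, ((L : ℝ) - hH.eigenvalues i) ^ R := by
    rw [← trace_pow_eig A hH]
    have : ((L : ℝ) • (1 : Matrix n n ℝ) - A) ^ R =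
      (Int.castRingHom ℝ).mapMatrix (((L : ℤ) • (1 : Matrix n n ℤ) - M) ^ R) := by
      rw [map_pow, map_sub, map_zsmul, map_one]
      congr 2
      ext i j
      by_cases hij : i = j
      · subst hij; simp
      · simp [hij]
    rw [this]
    simp [Matrix.trace]
  have hle : ∀ i, hH.eigenvalues i ≤ L := by
    apply eig_le
    intro i
    have := hL i
    have h2 : ((∑ j, |M i j| : ℤ) : ℝ) ≤ ((L : ℤ) : ℝ) := Int.cast_le.mpr this
    simpa [hA] using h2
  have h0 : ∀ i, 0 ≤ hH.eigenvalues i := hps.eigenvalues_nonneg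
  have hrank : (J.map (Int.cast : ℤ → ℝ)).rank = (Finset.univ.filter (fun i => hH.eigenvalues i ≠ 0)).card := by
    rw [← Matrix.rank_transpose_mul_self, ← hAJ, hH.rank_eq_card_non_zero_eigs, Fintype.card_subtype]
  have hcard := Finset.card_filter_add_card_filter_not (s := Finset.univ) (fun i => hH.eigenvalues i ≠ 0)
  rw [Finset.card_univ] at hcard
  have hnull : (Fintype.card n : ℝ) - (J.map (Int.cast : ℤ → ℝ)).rank =
     (Finset.univ.filter (fun i => ¬ hH.eigenvalues i ≠ 0)).card := by
    rw [hrank, ← hcard]; push_cast; ring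
  have hLpos : (0 : ℝ) < L := by exact_mod_cast hL1
  rw [htr, ← Finset.sum_filter_add_sum_filter_not Finset.univ (fun i => hH.eigenvalues i ≠ 0)]
  have hz : ∑ i ∈ Finset.univ.filter (fun i => ¬ hH.eigenvalues i ≠ 0), ((L : ℝ) - hH.eigenvalues i) ^ R =
     (Finset.univ.filter (fun i => ¬ hH.eigenvalues i ≠ 0)).card * (L : ℝ) ^ R := by
    rw [Finset.sum_congr rfl (g := fun _ => (L : ℝ) ^ R)]
    · simp
    · intro i hi
      have : hH.eigenvalues i = 0 := by simpa using hi
      rw [this, sub_zero]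
  rw [hz, hnull]
  constructor
  · have : 0 ≤ ∑ i ∈ Finset.univ.filter (fun i => hH.eigenvalues i ≠ 0), ((L : ℝ) - hH.eigenvalues i) ^ R :=
      Finset.sum_nonneg fun i _ => pow_nonneg (by linarith [hle i]) _
    linarith
  · set Z := Finset.univ.filter (fun i => hH.eigenvalues i ≠ 0) with hZ
    have hpos : ∀ i ∈ Z, 0 < hH.eigenvalues i := fun i hi =>
      lt_of_le_of_ne (h0 i) (Ne.symm (by simpa [hZ] using hi))
    have hp := prod_nonzero_eig M hH
    rw [abs_of_nonneg (Finset.prod_nonneg fun i _ => h0 i)] at hp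
    have hlog : 0 ≤ ∑ i ∈ Z, Real.log (hH.eigenvalues i) := by
      rw [← Real.log_prod (fun i hi => (hpos i hi).ne')]
      exact Real.log_nonneg hp
    have hb : ∑ i ∈ Z, ((L : ℝ) - hH.eigenvalues i) ^ R ≤
        ∑ i ∈ Z, (η * (1 + Real.log L - Real.log (hH.eigenvalues i))) * (L : ℝ) ^ R := by
      apply Finset.sum_le_sum
      intro i hi
      have h1 := hR (hH.eigenvalues i / L) (div_pos (hpos i hi) hLpos) ((div_le_one hLpos).mpr (hle i))
      rw [Real.log_div (hpos i hi).ne' hLpos.ne'] at h1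
      have h2 : ((L : ℝ) - hH.eigenvalues i) ^ R = (1 - hH.eigenvalues i / L) ^ R * (L : ℝ) ^ R := by
        rw [← mul_pow]; congr 1; field_simp
      rw [h2]
      apply mul_le_mul_of_nonneg_right _ (by positivity)
      linarith
    rw [← Finset.sum_mul, ← Finset.mul_sum, Finset.sum_sub_distrib] at hb
    simp only [Finset.sum_const, nsmul_eq_mul] at hb
    have hZc : (Z.card : ℝ) ≤ Fintype.card n := by exact_mod_cast Finset.card_le_univ Z
    have hlL : 0 ≤ Real.log L := Real.log_nonneg (by exact_mod_cast hL1)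
    have : η * (Z.card * (1 + Real.log L) - ∑ i ∈ Z, Real.log (hH.eigenvalues i)) ≤
        η * Fintype.card n * (1 + Real.log L) := by
      rw [mul_assoc]
      apply mul_le_mul_of_nonneg_left _ hη.le
      nlinarith
    have h3 := mul_le_mul_of_nonneg_right this (show (0 : ℝ) ≤ (L : ℝ) ^ R by positivity)
    rw [add_mul]
    linarith

end LG


namespace LG

theorem exists_cols {m n k : Type*} [Fintype m] [Fintype n] [Field k] (A : Matrix m n k)
    (q : ℕ) (hq : A.rank = q) :
    ∃ c : Fin q → n, LinearIndependent k (A.submatrix id c).transpose.row := by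
  rw [A.rank_eq_finrank_span_cols] at hq
  obtain ⟨f, h1, h2, h3⟩ := Submodule.exists_fun_fin_finrank_span_eq k (Set.range A.col)
  subst hq
  choose c hc using h1
  refine ⟨c, ?_⟩
  have h4 : (A.submatrix id c).transpose.row = f := funext hc
  rw [h4]
  exact h3

theorem exists_minor {m n k : Type*} [Fintype m] [Fintype n] [Field k] (A : Matrix m n k)
    (q : ℕ) (hq : A.rank = q) :
    ∃ (r : Fin q → m) (c : Fin q → n), (A.submatrix r c).det ≠ 0 := by
  obtain ⟨c, hc⟩ := exists_cols A q hq
  obtain ⟨r, hr⟩ := exists_cols (A.submatrix id c).transpose q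
    (by rw [hc.rank_matrix, Fintype.card_fin])
  refine ⟨r, c, ?_⟩
  have h2 : LinearIndependent k (A.submatrix r c).row := hr
  rw [Matrix.linearIndependent_rows_iff_isUnit, Matrix.isUnit_iff_isUnit_det] at h2
  exact h2.ne_zero

theorem rank_mod_le {m n : Type*} [Fintype m] [Fintype n] (l : ℕ) [Fact l.Prime] (M : Matrix m n ℤ) :
    (M.map (Int.cast : ℤ → ZMod l)).rank ≤ (M.map (Int.cast : ℤ → ℝ)).rank := by
  obtain ⟨r, c, h⟩ := exists_minor (M.map (Int.cast : ℤ → ZMod l)) _ rfl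
  have h1 : ((M.map (Int.cast : ℤ → ZMod l)).submatrix r c).det = (((M.submatrix r c).det : ℤ) : ZMod l) :=
    ((Int.castRingHom (ZMod l)).map_det (M.submatrix r c)).symm
  have h2 : ((M.map (Int.cast : ℤ → ℝ)).submatrix r c).det = (((M.submatrix r c).det : ℤ) : ℝ) :=
    ((Int.castRingHom ℝ).map_det (M.submatrix r c)).symm
  have h3 : ((M.map (Int.cast : ℤ → ℝ)).submatrix r c).det ≠ 0 := by
    rw [h2, Int.cast_ne_zero]
    intro h0
    rw [h1, h0] at h
    simp at h
  have h4 := Matrix.rank_of_det_ne_zero h3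
  rw [Fintype.card_fin] at h4
  rw [← h4]
  exact Matrix.rank_submatrix_le _ _ _

theorem finrank_ker {m n k : Type*} [Fintype m] [Fintype n] [Field k] (A : Matrix m n k) :
    A.rank + Module.finrank k (LinearMap.ker A.mulVecLin) = Fintype.card n := by
  have := A.mulVecLin.finrank_range_add_finrank_ker
  rwa [Module.finrank_fintype_fun_eq_card] at this

/-- p-group devissage -/
theorem pgroup_dim {V P : Type*} [Group P] [Fintype P] (l : ℕ) [Fact l.Prime] (hP : IsPGroup l P)
    [AddCommGroup V] [Module (ZMod l) V] [Finite V] (ρ : P →* Module.End (ZMod l) V)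
    (I : Submodule (ZMod l) V) (hI : ∀ v, (∀ g, ρ g v = v) → v ∈ I) :
    Module.finrank (ZMod l) V ≤ Fintype.card P * Module.finrank (ZMod l) I := by
  obtain ⟨π, hπ⟩ := I.subtype.exists_leftInverse_of_injective (by simp)
  let Ψ : V →ₗ[ZMod l] (P → I) := LinearMap.pi fun g => π.comp (ρ g)
  have hinj : Function.Injective Ψ := by
    rw [← LinearMap.ker_eq_bot]
    by_contra hne
    let S := LinearMap.ker Ψ
    have hS : ∀ g, ∀ v ∈ S, ρ g v ∈ S := by
      intro g v hv
      rw [LinearMap.mem_ker] at hv ⊢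
      ext1 h
      have := congrFun hv (h * g)
      simpa [Ψ] using this
    let _ : MulAction P S :=
      { smul := fun g v => ⟨ρ g v, hS g v v.2⟩
        one_smul := fun v => Subtype.ext (by change ρ 1 v.1 = v.1; simp)
        mul_smul := fun g h v => Subtype.ext (by change ρ (g * h) v.1 = ρ g (ρ h v.1); simp) }
    have hfin : Finite S := inferInstance
    have hnt : Nontrivial S := Submodule.nontrivial_iff_ne_bot.mpr hne
    have hcard : l ∣ Nat.card S := by
      rw [Module.natCard_eq_pow_finrank (K := ZMod l) (V := S), Nat.card_zmod]
      exact dvd_pow_self _ (Module.finrank_pos).ne'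
    obtain ⟨b, hb, hb0⟩ := hP.exists_fixed_point_of_prime_dvd_card_of_fixed_point S hcard
      (a := (0 : S)) (fun g => Subtype.ext (by change ρ g 0 = 0; simp))
    have hbI : b.1 ∈ I := hI _ fun g => congrArg Subtype.val (hb g)
    have h1 := congrFun (LinearMap.mem_ker.mp b.2) 1
    have h2 : π b.1 = 0 := by simpa [Ψ] using h1
    have h3 : π b.1 = ⟨b.1, hbI⟩ := congrArg (fun f => f ⟨b.1, hbI⟩) hπ
    rw [h2] at h3
    apply hb0
    exact Subtype.ext (show (0:V) = b.1 from congrArg (fun z : I => z.1) h3)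
  have := LinearMap.finrank_le_finrank_of_injective hinj
  rwa [Module.finrank_pi_fintype, Finset.sum_const, Finset.card_univ, smul_eq_mul] at this

end LG


namespace LG

open MonoidAlgebra

section D
variable {G : Type*} [Group G] {X : Type*} [Fintype X] [DecidableEq X] {ι : Type*} [Fintype ι]
variable {κ : Type*} [Fintype κ]

/-- permutation matrices -/
def pm (k : Type*) [CommRing k] (σ : G →* Equiv.Perm X) : G →* Matrix X X k where
  toFun g := Matrix.of fun x y => if (σ g)⁻¹ x = y then 1 else 0
  map_one' := by ext x y; simp [Matrix.one_apply]
  map_mul' g h := by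
    ext x y
    rw [Matrix.mul_apply, Finset.sum_eq_single ((σ g)⁻¹ x)]
    · simp
    · intro j _ hj
      simp only [Matrix.of_apply]
      rw [if_neg (Ne.symm hj), zero_mul]
    · simp

/-- linear extension -/
noncomputable def act (k : Type*) [CommRing k] (σ : G →* Equiv.Perm X) :
    MonoidAlgebra ℤ G →ₐ[ℤ] Matrix X X k := MonoidAlgebra.lift ℤ (Matrix X X k) G (pm k σ)

theorem act_of (k : Type*) [CommRing k] (σ : G →* Equiv.Perm X) (g : G) (v : X → k) (x : X) :
    (Matrix.mulVec (act k σ (of ℤ G g)) v) x = v ((σ g)⁻¹ x) := by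
  simp [act, pm, Matrix.mulVec, dotProduct]

theorem act_map (k : Type*) [CommRing k] (σ : G →* Equiv.Perm X) (a : MonoidAlgebra ℤ G) :
    (act ℤ σ a).map (Int.cast : ℤ → k) = act k σ a := by
  induction a using MonoidAlgebra.induction_linear with
  | zero => ext; simp
  | add a b ha hb => rw [map_add, map_add, ← ha, ← hb]; ext; simp
  | single g n =>
    ext x y
    simp [act, pm]

theorem act_apply (k : Type*) [CommRing k] (σ : G →* Equiv.Perm X) (a : MonoidAlgebra ℤ G) (x y : X) :
    act k σ a x y = ∑ g ∈ a.coeff.support, (a.coeff g : k) * if (σ g)⁻¹ x = y then 1 else 0 := by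
  simp only [act, MonoidAlgebra.lift_apply, Finsupp.sum, Matrix.sum_apply]
  refine Finset.sum_congr rfl fun g _ => ?_
  simp [pm]

/-- the adjoint -/
noncomputable def st (a : MonoidAlgebra ℤ G) : MonoidAlgebra ℤ G := MonoidAlgebra.mapDomain (·⁻¹) a

theorem act_st (σ : G →* Equiv.Perm X) (a : MonoidAlgebra ℤ G) :
    act ℤ σ (st a) = (act ℤ σ a).transpose := by
  unfold st
  induction a using MonoidAlgebra.induction_linear with
  | zero => ext; simp
  | add a b ha hb => rw [MonoidAlgebra.mapDomain_add, map_add, map_add, ha, hb]; ext; simp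
  | single g n =>
    ext x y
    have h1 : ((σ g⁻¹)⁻¹ x = y) ↔ ((σ g)⁻¹ y = x) := by
      rw [Equiv.Perm.inv_eq_iff_eq, map_inv]; exact eq_comm
    rw [Matrix.transpose_apply, act_apply, act_apply]
    simp only [MonoidAlgebra.mapDomain_single, MonoidAlgebra.coeff_single]
    by_cases hn : n = 0
    · simp [hn]
    rw [Finsupp.support_single _ hn, Finsupp.support_single _ hn]
    simp only [Finset.sum_singleton, Finsupp.single_eq_same, h1]

/-- crossed homomorphisms -/
def Cr {k : Type*} [CommRing k] (σ : G →* Equiv.Perm X) (δ : G → X → k) : Prop :=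
  ∀ g h x, δ (g * h) x = δ g x + δ h ((σ g)⁻¹ x)

/-- relations -/
def Syz (x : ι → G) : Set (ι → MonoidAlgebra ℤ G) := {a | ∑ j, a j * (of ℤ G (x j) - 1) = 0}

theorem CH1 {k : Type*} [CommRing k] (σ : G →* Equiv.Perm X) (δ : G → X → k) (hδ : Cr σ δ)
    (x : ι → G) (a : ι → MonoidAlgebra ℤ G) (ha : a ∈ Syz x) :
    ∑ j, Matrix.mulVec (act k σ (a j)) (δ (x j)) = 0 := by
  let D : MonoidAlgebra ℤ G →+ (X → k) :=
    { toFun := fun a => a.coeff.sum fun g n => n • δ g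
      map_zero' := by simp
      map_add' := fun a b => by
        rw [MonoidAlgebra.coeff_add]
        exact Finsupp.sum_add_index' (fun g => zero_smul ℤ (δ g)) (fun g m n => add_smul m n (δ g)) }
  have hD : ∀ (g : G) (n : ℤ), D (single g n) = n • δ g := fun g n => by
    change (single g n).coeff.sum (fun g n => n • δ g) = _
    rw [MonoidAlgebra.coeff_single, Finsupp.sum_single_index (by simp)]
  have key : ∀ (a : MonoidAlgebra ℤ G) (h : G), D (a * of ℤ G h) = D a + Matrix.mulVec (act k σ a) (δ h) := by
    intro a h
    induction a using MonoidAlgebra.induction_linear with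
    | zero => simp
    | add a b ha hb => rw [add_mul, map_add, map_add, map_add, ha, hb, Matrix.add_mulVec]; abel
    | single g n =>
      have h1 : single g n = n • of ℤ G g := by simp
      have h2 : single g n * of ℤ G h = single (g * h) n := by simp
      rw [h2, hD, hD, h1, map_smul]
      ext x
      rw [Matrix.smul_mulVec, Pi.add_apply, Pi.smul_apply, Pi.smul_apply, Pi.smul_apply, hδ, act_of, smul_add]
  have h0 : D (∑ j, a j * (of ℤ G (x j) - 1)) = 0 := by
    rw [show ∑ j, a j * (of ℤ G (x j) - 1) = 0 from ha, map_zero]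
  rw [map_sum] at h0
  rw [← h0]
  refine Finset.sum_congr rfl fun j _ => ?_
  rw [mul_sub, mul_one, map_sub, key]; abel

theorem exists_rep (x : ι → G) (hx : Subgroup.closure (Set.range x) = ⊤) [DecidableEq ι] (g : G) :
    ∃ a : ι → MonoidAlgebra ℤ G, of ℤ G g - 1 = ∑ j, a j * (of ℤ G (x j) - 1) := by
  have hg : g ∈ Subgroup.closure (Set.range x) := by rw [hx]; trivial
  induction hg using Subgroup.closure_induction with
  | mem g hg =>
    obtain ⟨j, rfl⟩ := hg
    refine ⟨Pi.single j 1, ?_⟩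
    rw [Finset.sum_eq_single j]
    · simp
    · intro i _ hi; simp [hi]
    · simp
  | one => exact ⟨0, by rw [map_one]; simp⟩
  | mul g h _ _ hg hh =>
    obtain ⟨a, ha⟩ := hg
    obtain ⟨b, hb⟩ := hh
    refine ⟨fun j => a j + of ℤ G g * b j, ?_⟩
    simp_rw [add_mul, Finset.sum_add_distrib, mul_assoc, ← Finset.mul_sum, ← ha, ← hb, map_mul, mul_sub]
    simp
  | inv g _ hg =>
    obtain ⟨a, ha⟩ := hg
    refine ⟨fun j => - (of ℤ G g⁻¹ * a j), ?_⟩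
    simp_rw [neg_mul, Finset.sum_neg_distrib, mul_assoc, ← Finset.mul_sum, ← ha, mul_sub, ← map_mul, inv_mul_cancel, map_one]
    simp

theorem CH2 {k : Type*} [CommRing k] (σ : G →* Equiv.Perm X) 
    (x : ι → G) (hx : Subgroup.closure (Set.range x) = ⊤) (v : ι → X → k)
    (hv : ∀ a ∈ Syz x, ∑ j, Matrix.mulVec (act k σ (a j)) (v j) = 0) :
    ∃ δ : G → X → k, Cr σ δ ∧ ∀ j, δ (x j) = v j := by
  classical
  choose a ha using exists_rep x hx
  have key : ∀ (g : G) (b : ι → MonoidAlgebra ℤ G), of ℤ G g - 1 = ∑ j, b j * (of ℤ G (x j) - 1) →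
      ∑ j, Matrix.mulVec (act k σ (a g j)) (v j) = ∑ j, Matrix.mulVec (act k σ (b j)) (v j) := by
    intro g b hb
    have : (fun j => a g j - b j) ∈ Syz x := by
      change ∑ j, (a g j - b j) * (of ℤ G (x j) - 1) = 0
      simp_rw [sub_mul, Finset.sum_sub_distrib, ← ha, ← hb, sub_self]
    have := hv _ this
    simp_rw [map_sub, Matrix.sub_mulVec, Finset.sum_sub_distrib] at this
    exact sub_eq_zero.mp this
  refine ⟨fun g => ∑ j, Matrix.mulVec (act k σ (a g j)) (v j), ?_, ?_⟩
  · intro g h y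
    have h1 := key (g * h) (fun j => a g j + of ℤ G g * a h j) (by
      simp_rw [add_mul, Finset.sum_add_distrib, mul_assoc, ← Finset.mul_sum, ← ha, map_mul, mul_sub]
      simp)
    simp only [] at h1 ⊢
    rw [h1]
    simp_rw [map_add, map_mul, Matrix.add_mulVec, Finset.sum_add_distrib, ← Matrix.mulVec_mulVec]
    rw [Pi.add_apply, Finset.sum_apply y _ (fun j => Matrix.mulVec (act k σ (of ℤ G g)) _)]
    simp_rw [act_of, Finset.sum_apply]
  · intro j
    have h1 := key (x j) (Pi.single j 1) (by
      rw [Finset.sum_eq_single j]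
      · simp
      · intro i _ hi; simp [hi]
      · simp)
    simp only []
    rw [h1, Finset.sum_eq_single j]
    · simp
    · intro i _ hi; simp [hi]
    · simp

/-- rectangular blow up -/
noncomputable def JX (k : Type*) [CommRing k] (σ : G →* Equiv.Perm X) (J : Matrix κ ι (MonoidAlgebra ℤ G)) :
    Matrix (κ × X) (ι × X) k := Matrix.of fun i j => act k σ (J i.1 j.1) i.2 j.2

theorem JX_map (k : Type*) [CommRing k] (σ : G →* Equiv.Perm X) (J : Matrix κ ι (MonoidAlgebra ℤ G)) :
    (JX ℤ σ J).map (Int.cast : ℤ → k) = JX k σ J := by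
  ext i j
  simp [JX, ← act_map k]

theorem JX_mulVec (k : Type*) [CommRing k] (σ : G →* Equiv.Perm X) (J : Matrix κ ι (MonoidAlgebra ℤ G))
    (v : ι × X → k) (i : κ) (x : X) :
    (JX k σ J).mulVec v (i, x) = (∑ j, (act k σ (J i j)).mulVec (fun y => v (j, y))) x := by
  simp [JX, Matrix.mulVec, dotProduct, Fintype.sum_prod_type, Finset.sum_apply]

/-- square blow up -/
noncomputable def bl [DecidableEq ι] (σ : G →* Equiv.Perm X) :
    Matrix ι ι (MonoidAlgebra ℤ G) →+* Matrix (ι × X) (ι × X) ℤ :=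
  (Matrix.compRingEquiv ι X ℤ).toRingHom.comp ((act ℤ σ).toRingHom.mapMatrix)

theorem bl_apply [DecidableEq ι] (σ : G →* Equiv.Perm X) (H : Matrix ι ι (MonoidAlgebra ℤ G)) (i j) :
    bl σ H i j = act ℤ σ (H i.1 j.1) i.2 j.2 := rfl

/-- the Laplacian -/
noncomputable def lap (J : Matrix κ ι (MonoidAlgebra ℤ G)) : Matrix ι ι (MonoidAlgebra ℤ G) :=
  Matrix.of fun i j => ∑ a, st (J a i) * J a j

theorem bl_lap [DecidableEq ι] (σ : G →* Equiv.Perm X) (J : Matrix κ ι (MonoidAlgebra ℤ G)) :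
    bl σ (lap J) = (JX ℤ σ J).transpose * JX ℤ σ J := by
  ext i j
  rw [bl_apply]
  simp only [lap, Matrix.of_apply, map_sum, map_mul, act_st, Matrix.mul_apply, Fintype.sum_prod_type, JX,
    Matrix.transpose_apply, Matrix.sum_apply]

/-- l1 norm -/
noncomputable def n1 (a : MonoidAlgebra ℤ G) : ℤ := ∑ g ∈ a.coeff.support, |a.coeff g|

theorem n1_nonneg (a : MonoidAlgebra ℤ G) : 0 ≤ n1 a := Finset.sum_nonneg fun _ _ => abs_nonneg _

theorem act_row (σ : G →* Equiv.Perm X) (a : MonoidAlgebra ℤ G) (x : X) :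
    ∑ y, |act ℤ σ a x y| ≤ n1 a := by
  calc ∑ y, |act ℤ σ a x y| ≤ ∑ y, ∑ g ∈ a.coeff.support, |a.coeff g| * if (σ g)⁻¹ x = y then 1 else 0 := by
        refine Finset.sum_le_sum fun y _ => ?_
        rw [act_apply]
        refine (Finset.abs_sum_le_sum_abs _ _).trans (Finset.sum_le_sum fun g _ => ?_)
        split_ifs <;> simp
    _ = n1 a := by
        rw [Finset.sum_comm]
        refine Finset.sum_congr rfl fun g _ => ?_
        simp

theorem bl_row [DecidableEq ι] (σ : G →* Equiv.Perm X) (H : Matrix ι ι (MonoidAlgebra ℤ G)) (i) :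
    ∑ j, |bl σ H i j| ≤ ∑ i, ∑ j, n1 (H i j) := by
  rw [Fintype.sum_prod_type]
  refine le_trans (Finset.sum_le_sum fun j _ => act_row σ (H i.1 j) i.2) ?_
  exact Finset.single_le_sum (f := fun i => ∑ j, n1 (H i j))
    (fun i _ => Finset.sum_nonneg fun j _ => n1_nonneg _) (Finset.mem_univ i.1)

theorem act_trace (σ : G →* Equiv.Perm X) (a : MonoidAlgebra ℤ G)
    (h : ∀ g ∈ a.coeff.support, g ≠ 1 → ∀ x, σ g x ≠ x) :
    (act ℤ σ a).trace = Fintype.card X * a.coeff 1 := by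
  classical
  simp only [Matrix.trace, Matrix.diag, act_apply, Int.cast_id]
  rw [Finset.sum_comm]
  have : ∀ g ∈ a.coeff.support, ∑ x, (a.coeff g : ℤ) * (if (σ g)⁻¹ x = x then 1 else 0)
      = if g = 1 then Fintype.card X * a.coeff 1 else 0 := by
    intro g hg
    split_ifs with h1
    · subst h1; simp [mul_comm]
    · refine Finset.sum_eq_zero fun x _ => ?_
      rw [if_neg, mul_zero]
      rw [Equiv.Perm.inv_eq_iff_eq]
      exact fun h2 => h g hg h1 x h2.symm
  rw [Finset.sum_congr rfl this]
  simp
  intro h; simp [h]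

theorem bl_trace [DecidableEq ι] (σ : G →* Equiv.Perm X) (H : Matrix ι ι (MonoidAlgebra ℤ G)) 
    (h : ∀ j, ∀ g ∈ (H j j).coeff.support, g ≠ 1 → ∀ x, σ g x ≠ x) :
    (bl σ H).trace = Fintype.card X * ∑ j, (H j j).coeff 1 := by
  simp only [Matrix.trace, Matrix.diag, bl_apply, Fintype.sum_prod_type]
  rw [Finset.mul_sum]
  exact Finset.sum_congr rfl fun j _ => act_trace σ (H j j) (h j)

end D

end LG


namespace LG
open MonoidAlgebra

/-- left multiplication through a homomorphism -/
def lm {G P : Type*} [Group G] [Group P] (φ : G →* P) : G →* Equiv.Perm P :=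
  (MulAction.toPermHom P P).comp φ

theorem lm_apply {G P : Type*} [Group G] [Group P] (φ : G →* P) (g : G) (q : P) : lm φ g q = φ g * q := rfl

theorem lm_inv {G P : Type*} [Group G] [Group P] (φ : G →* P) (g : G) (q : P) :
    (lm φ g)⁻¹ q = (φ g)⁻¹ * q := by
  rw [← map_inv, lm_apply, map_inv]

section F
universe u v
variable {G : Type*} [Group G] {C : Type u} [Group C] [Fintype C] [DecidableEq C] {ι : Type v} [Fintype ι]

/-- crossed homs with sum zero are inner -/
theorem inner_of_cr (l : ℕ) [Fact l.Prime] (χ : G →* C) (hχ : Function.Surjective χ)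
    (hl : ¬ l ∣ Fintype.card C)
    (hconj : ∀ (φ : χ.ker →* Multiplicative (ZMod l)) (g : G) (u : χ.ker) (u' : χ.ker),
      (u' : G) = g * u * g⁻¹ → φ u' = φ u)
    (δ : G → C → ZMod l) (hδ : Cr (lm χ) δ) (hs : ∀ g, ∑ c, δ g c = 0) :
    ∃ w : C → ZMod l, ∀ g c, δ g c = w c - w ((χ g)⁻¹ * c) := by
  have hcard : (Fintype.card C : ZMod l) ≠ 0 := by
    rwa [Ne, ZMod.natCast_eq_zero_iff]
  have hδ' : ∀ g h c, δ (g * h) c = δ g c + δ h ((χ g)⁻¹ * c) := fun g h c => by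
    rw [hδ, lm_inv]
  have hker : ∀ u : G, χ u = 1 → ∀ c, δ u c = 0 := by
    intro u hu
    have hconst : ∀ c d, δ u c = δ u d := by
      intro c d
      obtain ⟨g, hg⟩ := hχ (c * d⁻¹)
      let φ : χ.ker →* Multiplicative (ZMod l) := MonoidHom.mk' (fun u => Multiplicative.ofAdd (δ u c)) (by
        intro a b
        rw [← ofAdd_add]
        congr 1
        change δ (a.1 * b.1) c = _
        rw [hδ', show χ a.1 = 1 from a.2]
        simp)
      have h1 := hconj φ g ⟨u, hu⟩ ⟨g * u * g⁻¹, by simp [MonoidHom.mem_ker, hu]⟩ rfl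
      have h2 : δ (g * u * g⁻¹) c = δ u c := Multiplicative.ofAdd.injective h1
      have h3 := hδ' (g * u * g⁻¹) g c
      have h4 := hδ' g u c
      rw [inv_mul_cancel_right, h4] at h3
      have h5 : χ (g * u * g⁻¹) = 1 := by simp [hu]
      rw [h5, h2, hg] at h3
      simp only [mul_inv_rev, inv_inv, inv_one, one_mul, inv_mul_cancel_right] at h3
      rw [add_comm] at h3
      exact (add_right_cancel h3).symm
    intro c
    have h1 := hs u
    rw [Finset.sum_congr rfl (fun d _ => hconst d c), Finset.sum_const, Finset.card_univ, nsmul_eq_mul] at h1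
    exact (mul_eq_zero.mp h1).resolve_left hcard
  choose s hs' using hχ
  have hdesc : ∀ g c, δ g c = δ (s (χ g)) c := by
    intro g c
    have h1 := hδ' (s (χ g)) ((s (χ g))⁻¹ * g) c
    rw [mul_inv_cancel_left, hker ((s (χ g))⁻¹ * g) (by simp [hs']), add_zero] at h1
    exact h1
  refine ⟨fun c => (∑ d, δ (s d) c) / Fintype.card C, fun g c => ?_⟩
  have h1 : ∑ d, δ (s d) c = Fintype.card C * δ g c + ∑ d, δ (s d) ((χ g)⁻¹ * c) := by
    calc ∑ d, δ (s d) c = ∑ d, δ (s (χ g * d)) c :=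
          (Equiv.sum_comp (Equiv.mulLeft (χ g)) (fun d => δ (s d) c)).symm
      _ = ∑ d, δ (g * s d) c := by
          refine Finset.sum_congr rfl fun d _ => ?_
          rw [hdesc (g * s d), map_mul, hs']
      _ = _ := by
          simp_rw [hδ', Finset.sum_add_distrib]
          simp
  simp only []
  rw [h1]
  field_simp
  ring

/-- the auxiliary space -/
def Esub {κ : Type*} (l : ℕ) (χ : G →* C) (J : Matrix κ ι (MonoidAlgebra ℤ G)) :
    Submodule (ZMod l) (ι × C → ZMod l) where
  carrier := {v | (JX (ZMod l) (lm χ) J).mulVec v = 0 ∧ ∀ j, ∑ c, v (j, c) = 0}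
  add_mem' := by
    rintro a b ⟨ha, ha'⟩ ⟨hb, hb'⟩
    exact ⟨by rw [Matrix.mulVec_add, ha, hb, add_zero], fun j => by simp [Finset.sum_add_distrib, ha', hb']⟩
  zero_mem' := ⟨by simp, by simp⟩
  smul_mem' := by
    rintro r a ⟨ha, ha'⟩
    exact ⟨by rw [Matrix.mulVec_smul, ha, smul_zero], fun j => by simp [← Finset.mul_sum, ha']⟩

theorem exists_J (l : ℕ) [Fact l.Prime] (χ : G →* C) (hχ : Function.Surjective χ)
    (hl : ¬ l ∣ Fintype.card C)
    (hconj : ∀ (φ : χ.ker →* Multiplicative (ZMod l)) (g : G) (u : χ.ker) (u' : χ.ker),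
      (u' : G) = g * u * g⁻¹ → φ u' = φ u) (x : ι → G) (hx : Subgroup.closure (Set.range x) = ⊤) :
    ∃ (κ : Type (max u v)) (_ : Fintype κ) (J : Matrix κ ι (MonoidAlgebra ℤ G)),
      (∀ i, J i ∈ Syz x) ∧ Module.finrank (ZMod l) (Esub l χ J) + 1 ≤ Fintype.card C := by
  classical
  have hch : ∀ v : ι × C → ZMod l, ∃ a ∈ Syz x,
      ∑ j, Matrix.mulVec (act (ZMod l) (lm χ) (a j)) (fun y => v (j, y)) = 0 →
      ∀ a ∈ Syz x, ∑ j, Matrix.mulVec (act (ZMod l) (lm χ) (a j)) (fun y => v (j, y)) = 0 := by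
    intro v
    by_cases h : ∀ a ∈ Syz x, ∑ j, Matrix.mulVec (act (ZMod l) (lm χ) (a j)) (fun y => v (j, y)) = 0
    · exact ⟨0, by simp [Syz], fun _ => h⟩
    · push Not at h
      obtain ⟨a, ha, h⟩ := h
      exact ⟨a, ha, fun h' => absurd h' h⟩
  choose J hJ1 hJ2 using hch
  refine ⟨ι × C → ZMod l, inferInstance, J, hJ1, ?_⟩
  let Wm : (C → ZMod l) →ₗ[ZMod l] (ι × C → ZMod l) :=
    { toFun := fun w jc => w jc.2 - w ((χ (x jc.1))⁻¹ * jc.2)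
      map_add' := fun a b => by ext jc; simp; ring
      map_smul' := fun r a => by ext jc; simp; ring }
  have hE : Esub l χ J ≤ LinearMap.range Wm := by
    rintro v ⟨hv1, hv2⟩
    have h1 := hJ2 v (by
      ext c
      rw [← JX_mulVec (ZMod l) (lm χ) J v v c, hv1]; rfl)
    obtain ⟨δ, hδ, hδx⟩ := CH2 (lm χ) x hx (fun j y => v (j, y)) h1
    have hs : ∀ g, ∑ c, δ g c = 0 := by
      let S : G →* Multiplicative (ZMod l) := MonoidHom.mk' (fun g => Multiplicative.ofAdd (∑ c, δ g c)) (by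
        intro a b
        rw [← ofAdd_add]
        congr 1
        simp_rw [hδ a b, Finset.sum_add_distrib]
        congr 1
        exact Equiv.sum_comp ((lm χ a)⁻¹) (δ b))
      have hS : S = 1 := by
        refine MonoidHom.eq_of_eqOn_dense hx ?_
        rintro _ ⟨j, rfl⟩
        change Multiplicative.ofAdd (∑ c, δ (x j) c) = Multiplicative.ofAdd 0
        rw [hδx, hv2]
      intro g
      exact Multiplicative.ofAdd.injective (DFunLike.congr_fun hS g)
    obtain ⟨w, hw⟩ := inner_of_cr l χ hχ hl hconj δ hδ hs
    refine ⟨w, ?_⟩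
    ext jc
    change w jc.2 - w ((χ (x jc.1))⁻¹ * jc.2) = _
    rw [← hw, hδx]
  have h1 := Submodule.finrank_mono hE
  have h2 := Wm.finrank_range_add_finrank_ker
  rw [Module.finrank_fintype_fun_eq_card] at h2
  have h3 : 0 < Module.finrank (ZMod l) (LinearMap.ker Wm) := by
    rw [Module.finrank_pos_iff_exists_ne_zero]
    refine ⟨⟨fun _ => 1, ?_⟩, ?_⟩
    · rw [LinearMap.mem_ker]; ext jc; simp [Wm]
    · intro h
      have := congrFun (congrArg Subtype.val h) (1 : C)
      simp at this
  omega

end F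
end LG


namespace LG
open MonoidAlgebra

section H
variable {G : Type*} [Group G] {C P : Type*} [Group C] [Fintype C] [DecidableEq C] {ι κ : Type*} [Fintype ι]
  [Fintype κ] [DecidableEq ι] [Group P] [Fintype P] [DecidableEq P]

theorem act_mulVec {X : Type*} [Fintype X] [DecidableEq X] (k : Type*) [CommRing k] (σ : G →* Equiv.Perm X)
    (a : MonoidAlgebra ℤ G) (v : X → k) (x : X) :
    (act k σ a).mulVec v x = ∑ g ∈ a.coeff.support, (a.coeff g : k) * v ((σ g)⁻¹ x) := by
  simp only [Matrix.mulVec, dotProduct, act_apply, Finset.sum_mul]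
  rw [Finset.sum_comm]
  refine Finset.sum_congr rfl fun g _ => ?_
  simp

theorem JX_mulVec2 {X : Type*} [Fintype X] [DecidableEq X] (k : Type*) [CommRing k] (σ : G →* Equiv.Perm X)
    (J : Matrix κ ι (MonoidAlgebra ℤ G)) (v : ι × X → k) (i : κ) (x : X) :
    (JX k σ J).mulVec v (i, x) = ∑ j, ∑ g ∈ (J i j).coeff.support, ((J i j).coeff g : k) * v (j, (σ g)⁻¹ x) := by
  rw [JX_mulVec, Finset.sum_apply]
  simp_rw [act_mulVec]

theorem JX_equi {X Y : Type*} [Fintype X] [DecidableEq X] [Fintype Y] [DecidableEq Y]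
    (k : Type*) [CommRing k] (σ : G →* Equiv.Perm X) (τ : G →* Equiv.Perm Y) (r : X → Y)
    (hr : ∀ g x, r ((σ g)⁻¹ x) = (τ g)⁻¹ (r x))
    (J : Matrix κ ι (MonoidAlgebra ℤ G)) (v : ι × Y → k) (i : κ) (x : X) :
    (JX k σ J).mulVec (fun z => v (z.1, r z.2)) (i, x) = (JX k τ J).mulVec v (i, r x) := by
  rw [JX_mulVec2, JX_mulVec2]
  simp_rw [hr]

theorem JX_push (k : Type*) [CommRing k] (χ : G →* C) (φ : G →* P)
    (J : Matrix κ ι (MonoidAlgebra ℤ G)) (v : ι × (C × P) → k) (i : κ) (q : P) :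
    (JX k (lm φ) J).mulVec (fun z => ∑ c, v (z.1, (c, z.2))) (i, q) =
      ∑ c, (JX k (lm (χ.prod φ)) J).mulVec v (i, (c, q)) := by
  simp_rw [JX_mulVec2]
  rw [Finset.sum_comm]
  refine Finset.sum_congr rfl fun j _ => ?_
  rw [Finset.sum_comm]
  refine Finset.sum_congr rfl fun g _ => ?_
  rw [← Finset.mul_sum]
  congr 1
  simp_rw [lm_inv]
  exact (Equiv.sum_comp (Equiv.mulLeft (χ g)⁻¹) (fun c => v (j, (c, (φ g)⁻¹ * q)))).symm

/-- summation matrix -/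
def TX (ι C P : Type*) [DecidableEq ι] [DecidableEq P] (k : Type*) [CommRing k] :
    Matrix (ι × P) (ι × (C × P)) k :=
  Matrix.of fun a b => if a = (b.1, b.2.2) then 1 else 0

theorem TX_mulVec (k : Type*) [CommRing k] (v : ι × (C × P) → k) (j : ι) (q : P) :
    (TX ι C P k).mulVec v (j, q) = ∑ c, v (j, (c, q)) := by
  simp only [TX, Matrix.mulVec, dotProduct, Matrix.of_apply, Fintype.sum_prod_type, Prod.mk.injEq, ite_mul,
    one_mul, zero_mul]
  rw [Finset.sum_eq_single j]
  · simp
  · intro b _ hb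
    simp [Ne.symm hb]
  · simp

/-- stacked matrix -/
noncomputable def NX (k : Type*) [CommRing k] (χ : G →* C) (φ : G →* P) (J : Matrix κ ι (MonoidAlgebra ℤ G)) :
    Matrix ((κ × (C × P)) ⊕ (ι × P)) (ι × (C × P)) k :=
  Matrix.fromRows (JX k (lm (χ.prod φ)) J) (TX ι C P k)

theorem NX_map (k : Type*) [CommRing k] (χ : G →* C) (φ : G →* P) (J : Matrix κ ι (MonoidAlgebra ℤ G)) :
    (NX ℤ χ φ J).map (Int.cast : ℤ → k) = NX k χ φ J := by
  unfold NX
  rw [← JX_map k]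
  ext a b
  rcases a with a | a
  · rfl
  · simp [TX]

theorem NX_ker (k : Type*) [CommRing k] (χ : G →* C) (φ : G →* P) (J : Matrix κ ι (MonoidAlgebra ℤ G))
    (v : ι × (C × P) → k) : v ∈ LinearMap.ker (NX k χ φ J).mulVecLin ↔
    (JX k (lm (χ.prod φ)) J).mulVec v = 0 ∧ ∀ j q, ∑ c, v (j, (c, q)) = 0 := by
  rw [LinearMap.mem_ker, Matrix.mulVecLin_apply, NX, Matrix.fromRows_mulVec]
  constructor
  · intro h
    refine ⟨funext fun a => congrFun h (Sum.inl a), fun j q => ?_⟩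
    rw [← TX_mulVec]
    exact congrFun h (Sum.inr (j, q))
  · rintro ⟨h1, h2⟩
    ext (a | ⟨j, q⟩)
    · exact congrFun h1 a
    · change (TX ι C P k).mulVec v (j, q) = 0
      rw [TX_mulVec, h2]

theorem fact2 (χ : G →* C) (φ : G →* P) (J : Matrix κ ι (MonoidAlgebra ℤ G)) :
    Module.finrank ℝ (LinearMap.ker (JX ℝ (lm (χ.prod φ)) J).mulVecLin) ≤
      Module.finrank ℝ (LinearMap.ker (JX ℝ (lm φ) J).mulVecLin) +
      Module.finrank ℝ (LinearMap.ker (NX ℝ χ φ J).mulVecLin) := by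
  let K := LinearMap.ker (JX ℝ (lm (χ.prod φ)) J).mulVecLin
  let T : K →ₗ[ℝ] LinearMap.ker (JX ℝ (lm φ) J).mulVecLin :=
    ((TX ι C P ℝ).mulVecLin.comp K.subtype).codRestrict _ (by
      rintro ⟨v, hv⟩
      have hv' : (JX ℝ (lm (χ.prod φ)) J).mulVec v = 0 := hv
      rw [LinearMap.mem_ker, Matrix.mulVecLin_apply]
      have h1 : ((TX ι C P ℝ).mulVecLin.comp K.subtype) ⟨v, hv⟩ = fun z => ∑ c, v (z.1, (c, z.2)) := by
        ext ⟨j, q⟩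
        exact TX_mulVec ℝ v j q
      rw [h1]
      ext ⟨i, q⟩
      rw [JX_push ℝ χ φ, hv']
      simp)
  have h1 := T.finrank_range_add_finrank_ker
  have h2 := Submodule.finrank_le (LinearMap.range T)
  let E : LinearMap.ker T →ₗ[ℝ] LinearMap.ker (NX ℝ χ φ J).mulVecLin :=
    (K.subtype.comp (LinearMap.ker T).subtype).codRestrict _ (by
      rintro ⟨v, hv⟩
      rw [NX_ker]
      refine ⟨v.2, fun j q => ?_⟩
      have := congrFun (congrArg Subtype.val (LinearMap.mem_ker.mp hv)) (j, q)
      rw [← TX_mulVec]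
      exact this)
  have h3 : Module.finrank ℝ (LinearMap.ker T) ≤ _ := LinearMap.finrank_le_finrank_of_injective (f := E) (by
    intro a b hab
    have := congrArg Subtype.val hab
    exact Subtype.ext (Subtype.ext this))
  change Module.finrank ℝ K ≤ _
  omega

theorem fact3a (l : ℕ) [Fact l.Prime] (χ : G →* C) (φ : G →* P) (J : Matrix κ ι (MonoidAlgebra ℤ G)) :
    Module.finrank ℝ (LinearMap.ker (NX ℝ χ φ J).mulVecLin) ≤
    Module.finrank (ZMod l) (LinearMap.ker (NX (ZMod l) χ φ J).mulVecLin) := by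
  have h1 := rank_mod_le l (NX ℤ χ φ J)
  rw [NX_map, NX_map] at h1
  have h2 := finrank_ker (NX ℝ χ φ J)
  have h3 := finrank_ker (NX (ZMod l) χ φ J)
  omega

theorem fact3b (l : ℕ) [Fact l.Prime] (hP : IsPGroup l P)
    (χ : G →* C) (φ : G →* P) (J : Matrix κ ι (MonoidAlgebra ℤ G)) :
    Module.finrank (ZMod l) (LinearMap.ker (NX (ZMod l) χ φ J).mulVecLin) ≤
      Fintype.card P * Module.finrank (ZMod l) (Esub l χ J) := by
  let K := LinearMap.ker (NX (ZMod l) χ φ J).mulVecLin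
  let pull : Esub l χ J →ₗ[ZMod l] K :=
    ((LinearMap.funLeft (ZMod l) (ZMod l) (fun z : ι × (C × P) => (z.1, z.2.1))).comp
      (Esub l χ J).subtype).codRestrict _ (by
      rintro ⟨w, hw1, hw2⟩
      rw [NX_ker]
      refine ⟨?_, fun j q => hw2 j⟩
      ext ⟨i, x⟩
      have := JX_equi (ZMod l) (lm (χ.prod φ)) (lm χ) Prod.fst (fun g x => by simp [lm_inv]) J w i x
      rw [hw1] at this
      exact this)
  let ρ : P →* Module.End (ZMod l) K :=
    { toFun := fun r => ((LinearMap.funLeft (ZMod l) (ZMod l)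
          (fun z : ι × (C × P) => (z.1, (z.2.1, z.2.2 * r)))).comp K.subtype).codRestrict K (by
        rintro ⟨v, hv⟩
        have hv' := (NX_ker _ _ _ _ _).mp hv
        refine (NX_ker _ _ _ _ _).mpr ⟨?_, fun j q => hv'.2 j (q * r)⟩
        ext ⟨i, x⟩
        have := JX_equi (ZMod l) (lm (χ.prod φ)) (lm (χ.prod φ)) (fun x => (x.1, x.2 * r))
          (fun g x => by simp [lm_inv, mul_assoc]) J v i x
        rw [hv'.1] at this
        exact this)
      map_one' := by
        ext v z
        change v.1 (z.1, (z.2.1, z.2.2 * 1)) = v.1 z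
        rw [mul_one]
      map_mul' := fun r s => by
        ext v z
        change v.1 (z.1, (z.2.1, z.2.2 * (r * s))) = v.1 (z.1, (z.2.1, z.2.2 * r * s))
        rw [mul_assoc] }
  have h1 := pgroup_dim l hP ρ (LinearMap.range pull) (by
    intro v hv
    have hv' := (NX_ker _ _ _ _ _).mp v.2
    have hinv : ∀ z : ι × (C × P), v.1 z = v.1 (z.1, (z.2.1, 1)) := by
      intro z
      have := congrFun (congrArg Subtype.val (hv z.2.2)) (z.1, (z.2.1, 1))
      change v.1 (z.1, (z.2.1, 1 * z.2.2)) = v.1 _ at this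
      rw [one_mul] at this
      exact this
    have hw : (fun z : ι × C => v.1 (z.1, (z.2, 1))) ∈ Esub l χ J := by
      refine ⟨?_, fun j => hv'.2 j 1⟩
      ext ⟨i, c⟩
      have := JX_equi (ZMod l) (lm (χ.prod φ)) (lm χ) Prod.fst (fun g x => by simp [lm_inv]) J
        (fun z : ι × C => v.1 (z.1, (z.2, 1))) i (c, 1)
      rw [← this]
      have h3 : (fun z : ι × (C × P) => v.1 (z.1, (z.2.1, 1))) = v.1 := by
        ext z; exact (hinv z).symm
      change (JX (ZMod l) (lm (χ.prod φ)) J).mulVec (fun z : ι × (C × P) => v.1 (z.1, (z.2.1, 1))) (i, (c, 1)) = 0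
      rw [h3, hv'.1]
      rfl
    refine ⟨⟨_, hw⟩, ?_⟩
    ext z
    exact (hinv z).symm)
  have h2 := LinearMap.finrank_range_le pull
  exact h1.trans (Nat.mul_le_mul_left _ h2)

end H
end LG


namespace LG
open MonoidAlgebra

section I
variable {β P : Type*} [Group P] 

/-- affine action -/
def aff (ψ : FreeGroup β →* P) (w : β → P → ℝ) (b : β) : Equiv.Perm (P → ℝ) where
  toFun f := fun q => w b q + f ((ψ (FreeGroup.of b))⁻¹ * q)
  invFun f := fun q => f (ψ (FreeGroup.of b) * q) - w b (ψ (FreeGroup.of b) * q)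
  left_inv f := by ext q; simp
  right_inv f := by ext q; simp

theorem exists_cr [Fintype P] [DecidableEq P] (ψ : FreeGroup β →* P) (w : β → P → ℝ) :
    ∃ δ : FreeGroup β → P → ℝ, Cr (lm ψ) δ ∧ ∀ b, δ (FreeGroup.of b) = w b := by
  let Θ : FreeGroup β →* Equiv.Perm (P → ℝ) := FreeGroup.lift (aff ψ w)
  have key : ∀ g f q, Θ g f q = Θ g 0 q + f ((ψ g)⁻¹ * q) := by
    intro g
    induction g using FreeGroup.induction_on with
    | C1 => intro f q; simp
    | of b => intro f q; simp [Θ, aff]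
    | inv_of b _ =>
      intro f q
      have h : ∀ f q, Θ (FreeGroup.of b)⁻¹ f q = f (ψ (FreeGroup.of b) * q) - w b (ψ (FreeGroup.of b) * q) := by
        intro f q
        have : Θ (FreeGroup.of b)⁻¹ = (aff ψ w b)⁻¹ := by simp [Θ]
        rw [this]; rfl
      change Θ (FreeGroup.of b)⁻¹ f q = Θ (FreeGroup.of b)⁻¹ 0 q + f ((ψ (FreeGroup.of b)⁻¹)⁻¹ * q)
      rw [h, h]
      simp
      ring
    | mul g h hg hh =>
      intro f q
      rw [map_mul, Equiv.Perm.mul_apply, Equiv.Perm.mul_apply, hg, hg (Θ h 0), hh, map_mul, mul_inv_rev, mul_assoc]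
      ring
  refine ⟨fun g => Θ g 0, ?_, ?_⟩
  · intro g h q
    simp only [map_mul, Equiv.Perm.mul_apply, lm_inv]
    exact key g _ q
  · intro b
    ext q
    simp [Θ, aff]

variable {G : Type*} [Group G] {ι κ : Type*} [Fintype ι] [Fintype κ] [Fintype P] [DecidableEq P]

/-- space of crossed homs -/
def Zs (ψ : FreeGroup β →* P) : Submodule ℝ (FreeGroup β → P → ℝ) where
  carrier := {δ | Cr (lm ψ) δ}
  add_mem' := by
    intro a b ha hb g h q
    have h1 := ha g h q
    have h2 := hb g h q
    simp only [Pi.add_apply, h1, h2]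
    ring
  zero_mem' := by intro g h q; simp
  smul_mem' := by
    intro r a ha g h q
    have h1 := ha g h q
    simp only [Pi.smul_apply, h1, smul_add]

theorem fact1 (π : G →* FreeGroup β) (hπ : Function.Surjective π) (ψ : FreeGroup β →* P) (b₀ b₁ : β)
    (hb : b₀ ≠ b₁) (x : ι → G) (hx : Subgroup.closure (Set.range x) = ⊤)
    (J : Matrix κ ι (MonoidAlgebra ℤ G)) (hJ : ∀ i, J i ∈ Syz x) :
    2 * Fintype.card P ≤ Module.finrank ℝ (LinearMap.ker (JX ℝ (lm (ψ.comp π)) J).mulVecLin) := by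
  classical
  let A : Zs ψ →ₗ[ℝ] LinearMap.ker (JX ℝ (lm (ψ.comp π)) J).mulVecLin :=
    LinearMap.codRestrict _
      { toFun := fun δ jq => δ.1 (π (x jq.1)) jq.2
        map_add' := fun a b => rfl
        map_smul' := fun r a => rfl } (by
      rintro ⟨δ, hδ⟩
      rw [LinearMap.mem_ker, Matrix.mulVecLin_apply]
      ext ⟨i, q⟩
      rw [JX_mulVec]
      have := CH1 (lm (ψ.comp π)) (fun g => δ (π g)) (by
        intro g h q
        simp only [map_mul]
        exact hδ (π g) (π h) q) x (J i) (hJ i)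
      exact congrFun this q)
  have hA : Function.Injective A := by
    rw [injective_iff_map_eq_zero]
    rintro ⟨δ, hδ⟩ h0
    have hδ' : ∀ g h q, δ (g * h) q = δ g q + δ h ((ψ g)⁻¹ * q) := fun g h q => by
      rw [hδ g h q, lm_inv]
    have hone : ∀ q, δ 1 q = 0 := by
      intro q
      have := hδ' 1 1 q
      simp at this
      exact this
    have h1 : ∀ g : G, ∀ q, δ (π g) q = 0 := by
      intro g
      have hg : g ∈ Subgroup.closure (Set.range x) := by rw [hx]; trivial
      induction hg using Subgroup.closure_induction with
      | mem g hg =>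
        obtain ⟨j, rfl⟩ := hg
        intro q
        exact congrFun (congrArg Subtype.val h0) (j, q)
      | one => intro q; rw [map_one, hone]
      | mul g h _ _ hg hh => intro q; rw [map_mul, hδ', hg, hh, add_zero]
      | inv g _ hg =>
        intro q
        have := hδ' (π g)⁻¹ (π g) q
        rw [inv_mul_cancel, hone, hg, add_zero] at this
        rw [map_inv, ← this]
    ext g q
    obtain ⟨g, rfl⟩ := hπ g
    exact h1 g q
  have : Module.Finite ℝ (Zs ψ) := Module.Finite.of_injective A hA
  let B : Zs ψ →ₗ[ℝ] (P → ℝ) × (P → ℝ) :=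
    { toFun := fun δ => (δ.1 (FreeGroup.of b₀), δ.1 (FreeGroup.of b₁))
      map_add' := fun a b => rfl
      map_smul' := fun r a => rfl }
  have hB : Function.Surjective B := by
    rintro ⟨w0, w1⟩
    obtain ⟨δ, hδ, h⟩ := exists_cr ψ (fun b => if b = b₀ then w0 else w1)
    refine ⟨⟨δ, hδ⟩, ?_⟩
    change (δ (FreeGroup.of b₀), δ (FreeGroup.of b₁)) = _
    rw [h, h, if_pos rfl, if_neg hb.symm]
  have h1 := LinearMap.finrank_le_finrank_of_surjective hB
  have h2 := LinearMap.finrank_le_finrank_of_injective hA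
  rw [Module.finrank_prod, Module.finrank_fintype_fun_eq_card] at h1
  omega

end I
end LG


namespace LG
open scoped TensorProduct

theorem ell_choice (G : Type*) [Group G] [Group.FG G] (U : Subgroup G) [U.Normal]
    (hU : U.index ≠ 0) (hrk : rkQ U ≤ rkQ G) :
    ∃ l : ℕ, l.Prime ∧ ¬ l ∣ U.index ∧ ∀ (φ : U →* Multiplicative (ZMod l)) (g : G) (u : U) (u' : U),
      (u' : G) = g * u * g⁻¹ → φ u' = φ u := by
  have : U.FiniteIndex := ⟨hU⟩
  have hUfg : Group.FG U := inferInstance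
  have hU2 : Group.FG (Abelianization U) := QuotientGroup.fg _
  have hG2 : Group.FG (Abelianization G) := QuotientGroup.fg _
  have : Module.Finite ℤ (Additive (Abelianization U)) := Module.Finite.iff_addGroup_fg.mpr inferInstance
  have : Module.Finite ℤ (Additive (Abelianization G)) := Module.Finite.iff_addGroup_fg.mpr inferInstance
  let f : Additive (Abelianization U) →ₗ[ℤ] Additive (Abelianization G) :=
    (MonoidHom.toAdditive (Abelianization.map U.subtype)).toIntLinearMap
  let F := f.baseChange ℚ
  have hF : Function.Surjective F := by
    rw [← LinearMap.range_eq_top, eq_top_iff]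
    intro z _
    induction z using TensorProduct.induction_on with
    | zero => exact Submodule.zero_mem _
    | add a b ha hb => exact Submodule.add_mem _ (ha trivial) (hb trivial)
    | tmul q b =>
      obtain ⟨g, hg⟩ := QuotientGroup.mk_surjective (Additive.toMul b)
      refine ⟨(q / U.index) ⊗ₜ Additive.ofMul (Abelianization.of ⟨g ^ U.index, Subgroup.pow_index_mem U g⟩), ?_⟩
      have h1 : f (Additive.ofMul (Abelianization.of ⟨g ^ U.index, Subgroup.pow_index_mem U g⟩)) = (U.index : ℤ) • b := by
        rw [natCast_zsmul]
        have : b = Additive.ofMul (Abelianization.of g) := by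
          exact congrArg Additive.ofMul hg.symm
        rw [this]
        simp [f]
      change (q / U.index) ⊗ₜ f _ = _
      rw [h1, TensorProduct.tmul_smul, TensorProduct.smul_tmul']
      congr 1
      have : (U.index : ℚ) ≠ 0 := by exact_mod_cast hU
      simp; field_simp
  have hle := LinearMap.finrank_le_finrank_of_surjective hF
  have heq : Module.finrank ℚ (ℚ ⊗[ℤ] Additive (Abelianization U)) =
     Module.finrank ℚ (ℚ ⊗[ℤ] Additive (Abelianization G)) := le_antisymm hrk hle
  have hinj : Function.Injective F :=
    (LinearMap.injective_iff_surjective_of_finrank_eq_finrank heq).mpr hF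
  have htor : ∀ z : Additive (Abelianization U), f z = 0 → z ∈ Submodule.torsion ℤ (Additive (Abelianization U)) := by
    intro z hz
    have h1 : F (1 ⊗ₜ z) = 0 := by
      change 1 ⊗ₜ f z = 0
      rw [hz, TensorProduct.tmul_zero]
    have h2 : (TensorProduct.mk ℤ ℚ (Additive (Abelianization U)) 1) z = 0 := hinj (by rw [map_zero]; exact h1)
    rw [IsLocalizedModule.eq_zero_iff (nonZeroDivisors ℤ)] at h2
    exact h2
  have hann := Submodule.annihilator_top_inter_nonZeroDivisors (R := ℤ)
    (M := Submodule.torsion ℤ (Additive (Abelianization U))) (Submodule.torsion_isTorsion)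
  obtain ⟨e, he1, he2⟩ := hann
  have he0 : e ≠ 0 := nonZeroDivisors.ne_zero he2
  obtain ⟨l, hl1, hl2⟩ := Nat.exists_infinite_primes (e.natAbs + U.index + 1)
  refine ⟨l, hl2, fun h => ?_, fun φ g u u' hu => ?_⟩
  · have := Nat.le_of_dvd (Nat.pos_of_ne_zero hU) h
    omega
  · have : Fact l.Prime := ⟨hl2⟩
    let ψ : Additive (Abelianization U) →+ ZMod l := MonoidHom.toAdditiveLeft (Abelianization.lift φ)
    let z : Additive (Abelianization U) := Additive.ofMul (Abelianization.of u') - Additive.ofMul (Abelianization.of u)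
    have hz : f z = 0 := by
      rw [map_sub, sub_eq_zero]
      change Additive.ofMul (Abelianization.of (u' : G)) = Additive.ofMul (Abelianization.of (u : G))
      rw [hu]
      simp [mul_comm]
    have h1 := htor z hz
    have h2 : e • z = 0 := by
      have := (Submodule.mem_annihilator.mp he1) ⟨z, h1⟩ trivial
      exact congrArg Subtype.val this
    have h3 : (e : ZMod l) * ψ z = 0 := by
      rw [← zsmul_eq_mul, ← map_zsmul, h2, map_zero]
    have h4 : (e : ZMod l) ≠ 0 := by
      intro h
      rw [ZMod.intCast_zmod_eq_zero_iff_dvd, Int.natCast_dvd] at h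
      have := Nat.le_of_dvd (Int.natAbs_pos.mpr he0) h
      omega
    have h5 : ψ z = 0 := (mul_eq_zero.mp h3).resolve_left h4
    rw [map_sub, sub_eq_zero] at h5
    exact h5

end LG


namespace LG
open MonoidAlgebra

section K
variable {G : Type*} [Group G] {ι κ : Type*} [Fintype ι] [Fintype κ] [DecidableEq ι]

theorem luckQ {Q : Type*} [Group Q] [Fintype Q] [DecidableEq Q] (φ : G →* Q)
    (J : Matrix κ ι (MonoidAlgebra ℤ G)) (L : ℕ) (hL1 : 1 ≤ L) (hL : ∑ i, ∑ j, n1 (lap J i j) ≤ L)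
    (η : ℝ) (hη : 0 < η) (R : ℕ) (hR : ∀ t : ℝ, 0 < t → t ≤ 1 → (1 - t) ^ R ≤ η * (1 - Real.log t))
    (hφ : ∀ j, ∀ g ∈ ((((L : ℤ) • (1 : Matrix ι ι (MonoidAlgebra ℤ G)) - lap J) ^ R) j j).coeff.support,
      g ≠ 1 → φ g ≠ 1) :
    (Module.finrank ℝ (LinearMap.ker (JX ℝ (lm φ) J).mulVecLin) : ℝ) * L ^ R ≤ Fintype.card Q *
      ((∑ j, ((((L : ℤ) • (1 : Matrix ι ι (MonoidAlgebra ℤ G)) - lap J) ^ R) j j).coeff 1 : ℤ) : ℝ) ∧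
    (Fintype.card Q : ℝ) *
      ((∑ j, ((((L : ℤ) • (1 : Matrix ι ι (MonoidAlgebra ℤ G)) - lap J) ^ R) j j).coeff 1 : ℤ) : ℝ) ≤
    ((Module.finrank ℝ (LinearMap.ker (JX ℝ (lm φ) J).mulVecLin) : ℝ) +
      η * (Fintype.card ι * Fintype.card Q) * (1 + Real.log L)) * L ^ R := by
  have h1 := luck (JX ℤ (lm φ) J) L hL1 (fun i => by
    rw [← bl_lap]; exact (bl_row (lm φ) (lap J) i).trans hL) η hη R hR
  have h2 : ((L : ℤ) • (1 : Matrix (ι × Q) (ι × Q) ℤ) - (JX ℤ (lm φ) J).transpose * JX ℤ (lm φ) J) ^ R =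
      bl (lm φ) (((L : ℤ) • (1 : Matrix ι ι (MonoidAlgebra ℤ G)) - lap J) ^ R) := by
    rw [map_pow, map_sub, map_zsmul, map_one, bl_lap]
  rw [h2, bl_trace (lm φ) _ (fun j g hg hg1 x => by
    rw [lm_apply]; intro h; exact hφ j g hg hg1 (mul_eq_right.mp h)), JX_map] at h1
  have h3 := finrank_ker (JX ℝ (lm φ) J)
  have h4 : (Module.finrank ℝ (LinearMap.ker (JX ℝ (lm φ) J).mulVecLin) : ℝ) =
      (Fintype.card (ι × Q) : ℝ) - (JX ℝ (lm φ) J).rank := by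
    rw [← h3]; push_cast; ring
  rw [← h4, Fintype.card_prod] at h1
  push_cast at h1 ⊢
  exact h1

end K

theorem comm_of_subsingleton {β : Type*} [Subsingleton β] (a b : FreeGroup β) : a * b = b * a := by
  rcases isEmpty_or_nonempty β with h | ⟨⟨x⟩⟩
  · exact Subsingleton.elim _ _
  · have h1 : ∀ a : FreeGroup β, a ∈ Subgroup.zpowers (FreeGroup.of x) := by
      intro a
      have : a ∈ Subgroup.closure (Set.range (FreeGroup.of : β → FreeGroup β)) := by
        rw [FreeGroup.closure_range_of]; trivial
      rw [Subgroup.zpowers_eq_closure]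
      convert this
      ext z
      constructor
      · rintro rfl; exact ⟨x, rfl⟩
      · rintro ⟨y, rfl⟩; rw [Subsingleton.elim y x]; rfl
    obtain ⟨m, rfl⟩ := h1 a
    obtain ⟨n, rfl⟩ := h1 b
    exact zpow_mul_comm _ _ _

theorem exists_pi {G : Type*} [Group G] (hG : FullyResiduallyFree G) (hna : ¬ ∀ a b : G, a * b = b * a)
    (T : Finset G) : ∃ (β : Type) (π : G →* FreeGroup β), Function.Surjective π ∧
      (∃ b₀ b₁ : β, b₀ ≠ b₁) ∧ ∀ g ∈ T, g ≠ 1 → π g ≠ 1 := by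
  classical
  push Not at hna
  obtain ⟨a, b, hab⟩ := hna
  obtain ⟨α, f, hf⟩ := hG (T ∪ {1, a * b, b * a})
  let e := IsFreeGroup.toFreeGroup f.range
  let π : G →* FreeGroup (IsFreeGroup.Generators f.range) := e.toMonoidHom.comp f.rangeRestrict
  have hπ : ∀ g h, π g = π h → f g = f h := by
    intro g h hgh
    exact congrArg Subtype.val (e.injective hgh)
  refine ⟨IsFreeGroup.Generators f.range, π, e.surjective.comp f.rangeRestrict_surjective, ?_, ?_⟩
  · by_contra hcon
    push Not at hcon
    have : Subsingleton (IsFreeGroup.Generators f.range) := ⟨hcon⟩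
    apply hab
    apply hf (by simp) (by simp)
    apply hπ
    rw [map_mul, map_mul]
    exact comm_of_subsingleton _ _
  · intro g hg hg1 h
    apply hg1
    apply hf (by simp [hg]) (by simp)
    apply hπ
    rw [h, map_one]

theorem main {G C : Type*} [Group G] [Group C] [Fintype C] [DecidableEq C] {ι κ : Type*} [Fintype ι] [Fintype κ]
    [DecidableEq ι] (hG : FullyResiduallyFree G) (hna : ¬ ∀ a b : G, a * b = b * a)
    (hC : 2 ≤ Fintype.card C) (l : ℕ) [Fact l.Prime] (χ : G →* C)
    (x : ι → G) (hx : Subgroup.closure (Set.range x) = ⊤)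
    (J : Matrix κ ι (MonoidAlgebra ℤ G)) (hJ : ∀ i, J i ∈ Syz x)
    (hE : Module.finrank (ZMod l) (Esub l χ J) + 1 ≤ Fintype.card C) : False := by
  classical
  let L : ℕ := (∑ i, ∑ j, n1 (lap J i j)).toNat + 1
  have hL : ∑ i, ∑ j, n1 (lap J i j) ≤ L := by
    have := Int.self_le_toNat (∑ i, ∑ j, n1 (lap J i j))
    simp only [L]; push_cast; linarith
  have hL1 : 1 ≤ L := Nat.le_add_left _ _
  have hlog : 0 ≤ Real.log L := Real.log_natCast_nonneg _
  let E : ℝ := Fintype.card ι * Fintype.card C * (1 + Real.log L)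
  have hE0 : 0 ≤ E := by positivity
  let η : ℝ := 1 / (E + 1)
  have hη : 0 < η := by positivity
  have hηE : η * E < 1 := by
    rw [one_div_mul_eq_div, div_lt_one (by linarith)]; linarith
  obtain ⟨R, hR⟩ := exists_R η hη
  let T : Finset G := Finset.univ.biUnion fun j =>
    ((((L : ℤ) • (1 : Matrix ι ι (MonoidAlgebra ℤ G)) - lap J) ^ R) j j).coeff.support
  obtain ⟨β, π, hπ, ⟨b₀, b₁, hb⟩, hT⟩ := exists_pi hG hna T
  obtain ⟨P, _, hPf, hP, ψ, hψ⟩ := free_res l (Fact.out : l.Prime) (T.image π)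
  let _ : Fintype P := Fintype.ofFinite P
  have hfree : ∀ j, ∀ g ∈ ((((L : ℤ) • (1 : Matrix ι ι (MonoidAlgebra ℤ G)) - lap J) ^ R) j j).coeff.support,
      g ≠ 1 → (ψ.comp π) g ≠ 1 := by
    intro j g hg hg1
    have hgT : g ∈ T := Finset.mem_biUnion.mpr ⟨j, Finset.mem_univ _, hg⟩
    exact hψ _ (Finset.mem_image_of_mem _ hgT) (hT g hgT hg1)
  have h1 := (luckQ (ψ.comp π) J L hL1 hL η hη R hR hfree).1
  have h2 := (luckQ (χ.prod (ψ.comp π)) J L hL1 hL η hη R hR (fun j g hg hg1 h =>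
    hfree j g hg hg1 (congrArg Prod.snd h))).2
  have h3 := fact1 π hπ ψ b₀ b₁ hb x hx J hJ
  have h4 := fact2 χ (ψ.comp π) J
  have h5 := (fact3a l χ (ψ.comp π) J).trans (fact3b l hP χ (ψ.comp π) J)
  have hN : 0 < Fintype.card P := Fintype.card_pos
  generalize Module.finrank ℝ (LinearMap.ker (JX ℝ (lm (ψ.comp π)) J).mulVecLin) = nP at *
  generalize Module.finrank ℝ (LinearMap.ker (JX ℝ (lm (χ.prod (ψ.comp π))) J).mulVecLin) = nX at *
  generalize Module.finrank ℝ (LinearMap.ker (NX ℝ χ (ψ.comp π) J).mulVecLin) = nN at *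
  generalize Module.finrank (ZMod l) (Esub l χ J) = D at *
  generalize (∑ j, ((((L : ℤ) • (1 : Matrix ι ι (MonoidAlgebra ℤ G)) - lap J) ^ R) j j).coeff 1 : ℤ) = t at *
  rw [Fintype.card_prod] at h2
  have hLR : (0 : ℝ) < (L : ℝ) ^ R := by positivity
  push_cast at h2
  have hEdef : E = Fintype.card ι * Fintype.card C * (1 + Real.log L) := rfl
  generalize Fintype.card P = N at *
  have h2' : (Fintype.card C : ℝ) * N * t ≤ (nX + (η * E) * N) * (L : ℝ) ^ R := by
    rw [hEdef]
    calc _ ≤ _ := h2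
      _ = _ := by ring
  generalize Fintype.card C = c at *
  have h6 : (c : ℝ) * nP ≤ nX + (η * E) * N := by
    refine le_of_mul_le_mul_right ?_ hLR
    calc (c : ℝ) * nP * (L : ℝ) ^ R = c * (nP * (L : ℝ) ^ R) := by ring
      _ ≤ c * (N * t) := mul_le_mul_of_nonneg_left h1 (by positivity)
      _ = c * N * t := by ring
      _ ≤ _ := h2'
  have hN' : (0 : ℝ) < N := by exact_mod_cast hN
  have h7 : (c : ℝ) * nP < nX + N := by nlinarith
  have h8 : c * nP < nX + N := by exact_mod_cast h7
  have h9 : N * D + N ≤ N * c := by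
    calc N * D + N = N * (D + 1) := by ring
      _ ≤ _ := Nat.mul_le_mul_left _ hE
  obtain ⟨c', rfl⟩ := Nat.exists_eq_add_of_le hC
  nlinarith [Nat.mul_le_mul_left (1 + c') h3]

end LG

theorem rkQ_lt_of_normal_prime_index (G : Type*) [Group G] [Group.FG G]
    (hG : FullyResiduallyFree G) (hna : ¬ ∀ a b : G, a * b = b * a)
    (U : Subgroup G) [U.Normal] (p : ℕ) (hp : p.Prime) (hU : U.index = p) :
    rkQ G < rkQ ↥U := by
  classical
  by_contra hcon
  push Not at hcon
  have hU0 : U.index ≠ 0 := by rw [hU]; exact hp.ne_zero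
  obtain ⟨l, hl, hldvd, hconj⟩ := LG.ell_choice G U hU0 hcon
  have : Fact l.Prime := ⟨hl⟩
  have : U.FiniteIndex := ⟨hU0⟩
  let _ : Fintype (G ⧸ U) := Fintype.ofFinite _
  have hcard : Fintype.card (G ⧸ U) = U.index := by
    rw [Subgroup.index_eq_card, Nat.card_eq_fintype_card]
  obtain ⟨S, hS⟩ := (Group.FG.out : (⊤ : Subgroup G).FG)
  have hx : Subgroup.closure (Set.range (fun s : S => (s : G))) = ⊤ := by
    rw [← hS]; congr 1; ext; simp
  obtain ⟨κ, _, J, hJ, hE⟩ := LG.exists_J l (QuotientGroup.mk' U) (QuotientGroup.mk'_surjective U)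
    (by rw [hcard]; exact hldvd) (by rw [QuotientGroup.ker_mk']; exact hconj) (fun s : S => (s : G)) hx
  exact LG.main hG hna (by rw [hcard, hU]; exact hp.two_le) l (QuotientGroup.mk' U) _ hx J hJ hE
end

section
/- Let G = G₁ ∗_C G₂ be an amalgamated product where G₁ and G₂ are non-abelian finitely generated free groups and C is infinite cyclic, and suppose U is a normal subgroup of G of prime index p with G = U·G₁ = U·G₂ and |C : C ∩ U| = p. Then rk_Q(U) ≥ d(U ∩ G₁) + d(U ∩ G₂) − 1 ≥ d(G₁) + d(G₂) + 1 > d(G). -/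
open scoped TensorProduct

/-- The amalgamated free product `G₁ ∗_H G₂` along `f₁ : H →* G₁`, `f₂ : H →* G₂`. -/
def AmalgamatedProduct {G₁ G₂ H : Type*} [Group G₁] [Group G₂] [Group H]
    (f₁ : H →* G₁) (f₂ : H →* G₂) : Type _ :=
  Monoid.Coprod G₁ G₂ ⧸ Subgroup.normalClosure
    (Set.range fun h => Monoid.Coprod.inl (f₁ h) * (Monoid.Coprod.inr (f₂ h))⁻¹)

instance {G₁ G₂ H : Type*} [Group G₁] [Group G₂] [Group H]
    (f₁ : H →* G₁) (f₂ : H →* G₂) : Group (AmalgamatedProduct f₁ f₂) :=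
  QuotientGroup.Quotient.group _

/-- The canonical map `G₁ →* G₁ ∗_H G₂`. -/
def AmalgamatedProduct.inl {G₁ G₂ H : Type*} [Group G₁] [Group G₂] [Group H]
    (f₁ : H →* G₁) (f₂ : H →* G₂) : G₁ →* AmalgamatedProduct f₁ f₂ :=
  (QuotientGroup.mk' _).comp Monoid.Coprod.inl

/-- The canonical map `G₂ →* G₁ ∗_H G₂`. -/
def AmalgamatedProduct.inr {G₁ G₂ H : Type*} [Group G₁] [Group G₂] [Group H]
    (f₁ : H →* G₁) (f₂ : H →* G₂) : G₂ →* AmalgamatedProduct f₁ f₂ :=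
  (QuotientGroup.mk' _).comp Monoid.Coprod.inr

section RkQHelpers

/-- cocycles over a permutation representation -/
def CDer {H X : Type*} [Group H] (ρ : H →* Equiv.Perm X) : Submodule ℚ (H → X → ℚ) where
  carrier := {δ | ∀ g h x, δ (g * h) x = δ g x + δ h ((ρ g)⁻¹ x)}
  add_mem' := by
    intro a b ha hb g h x
    simp only [Set.mem_ofPred_eq, Pi.add_apply] at *
    rw [ha, hb]; ring
  zero_mem' := by intro g h x; simp
  smul_mem' := by
    intro c a ha g h x
    simp only [Set.mem_ofPred_eq, Pi.smul_apply, smul_eq_mul] at *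
    rw [ha]; ring

/-- homs to the rationals -/
def HomQ (H : Type*) [Group H] : Submodule ℚ (H → ℚ) where
  carrier := {f | ∀ g h, f (g * h) = f g + f h}
  add_mem' := by
    intro a b ha hb g h
    simp only [Set.mem_ofPred_eq, Pi.add_apply] at *
    rw [ha, hb]; ring
  zero_mem' := by intro g h; simp
  smul_mem' := by
    intro c a ha g h
    simp only [Set.mem_ofPred_eq, Pi.smul_apply, smul_eq_mul] at *
    rw [ha]; ring

theorem HomQ.mul {H : Type*} [Group H] (f : HomQ H) (g h : H) :
    f.1 (g * h) = f.1 g + f.1 h := f.2 g h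

theorem HomQ.one {H : Type*} [Group H] (f : HomQ H) : f.1 1 = 0 := by
  have := (HomQ.mul f) 1 1
  simpa using this

theorem HomQ.inv {H : Type*} [Group H] (f : HomQ H) (g : H) : f.1 g⁻¹ = - f.1 g := by
  have := (HomQ.mul f) g⁻¹ g
  rw [inv_mul_cancel, (HomQ.one f)] at this
  linarith

/-- as monoid hom -/
def HomQ.toHom {H : Type*} [Group H] (f : HomQ H) : H →* Multiplicative ℚ where
  toFun g := Multiplicative.ofAdd (f.1 g)
  map_one' := by rw [(HomQ.one f)]; rfl
  map_mul' g h := by rw [(HomQ.mul f)]; rfl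

theorem CDer.mul {H X : Type*} [Group H] {ρ : H →* Equiv.Perm X} (δ : CDer ρ) (g h : H) (x : X) :
    δ.1 (g * h) x = δ.1 g x + δ.1 h ((ρ g)⁻¹ x) := δ.2 g h x

theorem CDer.one {H X : Type*} [Group H] {ρ : H →* Equiv.Perm X} (δ : CDer ρ) (x : X) :
    δ.1 1 x = 0 := by
  have := (CDer.mul δ) 1 1 x
  simpa using this

/-- action on functions -/
def permAct (X : Type*) : Equiv.Perm X →* MulAut (Multiplicative (X → ℚ)) where
  toFun σ :=
    { toFun := fun a => Multiplicative.ofAdd (fun x => a.toAdd (σ⁻¹ x))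
      invFun := fun a => Multiplicative.ofAdd (fun x => a.toAdd (σ x))
      left_inv := by intro a; simp
      right_inv := by intro a; simp
      map_mul' := by intro a b; rfl }
  map_one' := by ext; rfl
  map_mul' σ τ := by ext a; rfl

/-- target of twisted homs -/
abbrev Tw (X : Type*) := Multiplicative (X → ℚ) ⋊[permAct X] Equiv.Perm X

/-- cocycle to hom -/
def CDer.toTw {H X : Type*} [Group H] {ρ : H →* Equiv.Perm X} (δ : CDer ρ) : H →* Tw X where
  toFun g := ⟨Multiplicative.ofAdd (δ.1 g), ρ g⟩
  map_one' := by
    ext x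
    · exact (CDer.one δ) _
    · simp
  map_mul' g h := by
    ext x
    · exact (CDer.mul δ) g h _
    · simp

/-- hom to cocycle -/
def CDer.ofTw {H X : Type*} [Group H] {ρ : H →* Equiv.Perm X} (Ψ : H →* Tw X)
    (h : SemidirectProduct.rightHom.comp Ψ = ρ) : CDer ρ :=
  ⟨fun g => (Ψ g).left.toAdd, by
    intro a b x
    subst h
    simp only [map_mul, SemidirectProduct.mul_left]
    rfl⟩

theorem CDer.ext_tw {H X : Type*} [Group H] {ρ : H →* Equiv.Perm X} {δ ε : CDer ρ}
    (h : (CDer.toTw δ) = (CDer.toTw ε)) : δ = ε := by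
  ext g x
  have := congrArg (fun t : Tw X => t.left.toAdd x) (DFunLike.congr_fun h g)
  exact this

/-- restriction to generators -/
def CDer.freeEval {α X : Type*} (ρ : FreeGroup α →* Equiv.Perm X) :
    CDer ρ →ₗ[ℚ] (α → X → ℚ) where
  toFun δ i := δ.1 (FreeGroup.of i)
  map_add' _ _ := rfl
  map_smul' _ _ := rfl

theorem CDer.freeEval_bij {α X : Type*} (ρ : FreeGroup α →* Equiv.Perm X) :
    Function.Bijective (CDer.freeEval ρ) := by
  constructor
  · intro δ ε h
    apply CDer.ext_tw
    apply FreeGroup.ext_hom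
    intro i
    have := congrFun h i
    change (⟨Multiplicative.ofAdd (δ.1 _), _⟩ : Tw X) = ⟨Multiplicative.ofAdd (ε.1 _), _⟩
    rw [show δ.1 (FreeGroup.of i) = ε.1 (FreeGroup.of i) from this]
  · intro a
    refine ⟨CDer.ofTw (FreeGroup.lift fun i => ⟨Multiplicative.ofAdd (a i), ρ (FreeGroup.of i)⟩) ?_, ?_⟩
    · apply FreeGroup.ext_hom
      intro i
      simp
    · ext i x
      simp [CDer.freeEval, CDer.ofTw]

/-- equivalence -/
noncomputable def CDer.freeEquiv {α X : Type*} (ρ : FreeGroup α →* Equiv.Perm X) :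
    CDer ρ ≃ₗ[ℚ] (α → X → ℚ) := LinearEquiv.ofBijective _ (CDer.freeEval_bij ρ)

theorem CDer.free_finrank {m : ℕ} {X : Type*} [Finite X] (ρ : FreeGroup (Fin m) →* Equiv.Perm X) :
    Module.Finite ℚ (CDer ρ) ∧ Module.finrank ℚ (CDer ρ) = m * Nat.card X := by
  have := Fintype.ofFinite X
  constructor
  · exact Module.Finite.equiv (CDer.freeEquiv ρ).symm
  · rw [(CDer.freeEquiv ρ).finrank_eq, Module.finrank_pi_fintype]
    simp

/-! Shapiro -/

/-- evaluation at base coset -/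
def CDer.shapiro {G : Type*} [Group G] (U : Subgroup G) :
    CDer (MulAction.toPermHom G (G ⧸ U)) →ₗ[ℚ] HomQ U where
  toFun δ := ⟨fun u => δ.1 u ((1 : G) : G ⧸ U), by
    intro u v
    simp only [Subgroup.coe_mul]
    rw [(CDer.mul δ)]
    have h2 : (u : G)⁻¹ • ((1 : G) : G ⧸ U) = ((1 : G) : G ⧸ U) := by
      change ((((u : G)⁻¹ * 1 : G)) : G ⧸ U) = _
      rw [QuotientGroup.eq]
      simp
    have h3 : ((MulAction.toPermHom G (G ⧸ U)) (u : G))⁻¹ ((1 : G) : G ⧸ U) = ((1 : G) : G ⧸ U) := h2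
    rw [h3]⟩
  map_add' _ _ := rfl
  map_smul' _ _ := rfl

theorem CDer.shapiro_surj {G : Type*} [Group G] (U : Subgroup G) :
    Function.Surjective (CDer.shapiro U) := by
  intro f
  let s : G ⧸ U → G := Quotient.out
  have hs : ∀ x, ((s x : G) : G ⧸ U) = x := fun x => Quotient.out_eq' x
  have hmem : ∀ (g : G) (x : G ⧸ U), (s x)⁻¹ * g * s (g⁻¹ • x) ∈ U := by
    intro g x
    rw [mul_assoc, ← QuotientGroup.eq, hs]
    have : ((g * s (g⁻¹ • x) : G) : G ⧸ U) = g • ((s (g⁻¹ • x) : G) : G ⧸ U) := rfl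
    rw [this, hs, smul_inv_smul]
  refine ⟨⟨fun g x => f.1 ⟨_, hmem g x⟩, ?_⟩, ?_⟩
  · intro g h x
    rw [← map_inv]
    change f.1 ⟨_, hmem (g * h) x⟩ = f.1 ⟨_, hmem g x⟩ + f.1 ⟨_, hmem h (g⁻¹ • x)⟩
    rw [← (HomQ.mul f)]
    refine congrArg f.1 ?_
    apply Subtype.ext
    simp only [Subgroup.coe_mul, mul_inv_rev, mul_smul]
    group
  · apply Subtype.ext
    funext u
    have h1 : s ((1 : G) : G ⧸ U) ∈ U := by
      have := (QuotientGroup.eq (s := U)).1 (hs ((1 : G) : G ⧸ U))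
      simpa using this
    have h2 : (u : G)⁻¹ • ((1 : G) : G ⧸ U) = ((1 : G) : G ⧸ U) := by
      change ((((u : G)⁻¹ * 1 : G)) : G ⧸ U) = _
      rw [QuotientGroup.eq]
      simp
    change f.1 ⟨_, hmem u _⟩ = f.1 u
    have : (⟨_, hmem u ((1 : G) : G ⧸ U)⟩ : U) = (⟨_, h1⟩ : U)⁻¹ * u * ⟨_, h1⟩ := by
      apply Subtype.ext
      simp [h2]
    rw [this, (HomQ.mul f), (HomQ.mul f), (HomQ.inv f)]
    ring

/-- functions vanishing at the base coset -/
def basedFun {G : Type*} [Group G] (U : Subgroup G) : Submodule ℚ (G ⧸ U → ℚ) :=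
  LinearMap.ker (LinearMap.proj (R := ℚ) (φ := fun _ : G ⧸ U => ℚ) ((1 : G) : G ⧸ U))

theorem basedFun_finrank {G : Type*} [Group G] (U : Subgroup G) [Finite (G ⧸ U)] :
    Module.finrank ℚ (basedFun U) + 1 = U.index := by
  have := Fintype.ofFinite (G ⧸ U)
  have h := LinearMap.finrank_range_add_finrank_ker
    (LinearMap.proj (R := ℚ) (φ := fun _ : G ⧸ U => ℚ) ((1 : G) : G ⧸ U))
  have h2 : LinearMap.range
    (LinearMap.proj (R := ℚ) (φ := fun _ : G ⧸ U => ℚ) ((1 : G) : G ⧸ U)) = ⊤ :=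
    LinearMap.range_eq_top.2 (LinearMap.proj_surjective _)
  rw [h2, finrank_top, Module.finrank_self, Module.finrank_fintype_fun_eq_card,
    ← Nat.card_eq_fintype_card] at h
  rw [Subgroup.index, ← h, add_comm]
  rfl

/-- coboundary -/
def CDer.cob {G : Type*} [Group G] (U : Subgroup G) :
    basedFun U →ₗ[ℚ] CDer (MulAction.toPermHom G (G ⧸ U)) where
  toFun φ := ⟨fun g x => φ.1 x - φ.1 (g⁻¹ • x), by
    intro g h x
    rw [← map_inv]
    change φ.1 x - φ.1 ((g * h)⁻¹ • x) = φ.1 x - φ.1 (g⁻¹ • x) +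
      (φ.1 (g⁻¹ • x) - φ.1 (h⁻¹ • g⁻¹ • x))
    simp only [mul_inv_rev, mul_smul]
    ring⟩
  map_add' a b := by
    apply Subtype.ext; funext g x
    simp; ring
  map_smul' a b := by
    apply Subtype.ext; funext g x
    simp; ring

theorem CDer.cob_inj {G : Type*} [Group G] (U : Subgroup G) :
    Function.Injective (CDer.cob U) := by
  rw [injective_iff_map_eq_zero]
  intro φ h
  have h0 : φ.1 ((1 : G) : G ⧸ U) = 0 := φ.2
  apply Subtype.ext
  funext x
  induction x using QuotientGroup.induction_on with
  | H g =>
    have : φ.1 (g : G ⧸ U) - φ.1 (g⁻¹ • (g : G ⧸ U)) = 0 :=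
      congrFun (congrFun (congrArg Subtype.val h) g) (g : G ⧸ U)
    have h2 : g⁻¹ • (g : G ⧸ U) = ((1 : G) : G ⧸ U) := by
      change ((g⁻¹ * g : G) : G ⧸ U) = _
      simp
    rw [h2, h0] at this
    simpa using this

theorem CDer.range_cob {G : Type*} [Group G] (U : Subgroup G) :
    LinearMap.range (CDer.cob U) = LinearMap.ker (CDer.shapiro U) := by
  apply le_antisymm
  · rintro _ ⟨φ, rfl⟩
    rw [LinearMap.mem_ker]
    apply Subtype.ext
    funext u
    change φ.1 ((1 : G) : G ⧸ U) - φ.1 ((u : G)⁻¹ • ((1 : G) : G ⧸ U)) = 0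
    have h2 : (u : G)⁻¹ • ((1 : G) : G ⧸ U) = ((1 : G) : G ⧸ U) := by
      change ((((u : G)⁻¹ * 1 : G)) : G ⧸ U) = _
      rw [QuotientGroup.eq]
      simp
    rw [h2, sub_self]
  · intro δ hδ
    have hu : ∀ u : U, δ.1 (u : G) ((1 : G) : G ⧸ U) = 0 := fun u =>
      congrFun (congrArg Subtype.val (LinearMap.mem_ker.1 hδ)) u
    have key : ∀ g h : G, δ.1 (g * h) ((g * h : G) : G ⧸ U) =
        δ.1 g ((g * h : G) : G ⧸ U) + δ.1 h (h : G ⧸ U) := by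
      intro g h
      rw [(CDer.mul δ)]
      have h2 : g⁻¹ • ((g * h : G) : G ⧸ U) = (h : G ⧸ U) := by
        change ((g⁻¹ * (g * h) : G) : G ⧸ U) = _
        rw [inv_mul_cancel_left]
      have h3 : ((MulAction.toPermHom G (G ⧸ U)) g)⁻¹ ((g * h : G) : G ⧸ U) = (h : G ⧸ U) := h2
      rw [h3]
    let φ : G ⧸ U → ℚ := Quotient.lift (fun g : G => δ.1 g (g : G ⧸ U)) (by
      intro a b hab
      have hab' : a⁻¹ * b ∈ U := QuotientGroup.leftRel_apply.1 hab
      have h := key a (a⁻¹ * b)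
      have e : ((a⁻¹ * b : G) : G ⧸ U) = ((1 : G) : G ⧸ U) := by
        rw [QuotientGroup.eq]; simpa using U.inv_mem hab'
      rw [e, hu ⟨_, hab'⟩, mul_inv_cancel_left, add_zero] at h
      have e2 : (a : G ⧸ U) = (b : G ⧸ U) := QuotientGroup.eq.2 hab'
      change δ.1 a (a : G ⧸ U) = δ.1 b (b : G ⧸ U)
      rw [h, e2])
    have hφ : ∀ g : G, φ (g : G ⧸ U) = δ.1 g (g : G ⧸ U) := fun g => rfl
    refine ⟨⟨φ, ?_⟩, ?_⟩
    · change φ ((1 : G) : G ⧸ U) = 0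
      rw [hφ]; exact hu 1
    · apply Subtype.ext
      funext g x
      induction x using QuotientGroup.induction_on with
      | H k =>
        change φ (k : G ⧸ U) - φ ((g⁻¹ * k : G) : G ⧸ U) = δ.1 g (k : G ⧸ U)
        have h := key g (g⁻¹ * k)
        rw [mul_inv_cancel_left] at h
        rw [hφ, hφ, h]; ring

theorem HomQ.finrank_index {G : Type*} [Group G] (U : Subgroup G) [Finite (G ⧸ U)]
    [Module.Finite ℚ (CDer (MulAction.toPermHom G (G ⧸ U)))] :
    Module.Finite ℚ (HomQ U) ∧ Module.finrank ℚ (HomQ U) + U.index =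
      Module.finrank ℚ (CDer (MulAction.toPermHom G (G ⧸ U))) + 1 := by
  refine ⟨Module.Finite.of_surjective _ (CDer.shapiro_surj U), ?_⟩
  have h := LinearMap.finrank_range_add_finrank_ker (CDer.shapiro U)
  rw [LinearMap.range_eq_top.2 (CDer.shapiro_surj U), finrank_top, ← CDer.range_cob,
    LinearMap.finrank_range_of_inj (CDer.cob_inj U)] at h
  have := basedFun_finrank U
  omega

/-! d -/

theorem d_spec {H : Type*} [Group H] [Group.FG H] :
    ∃ S : Finset H, S.card = d H ∧ Subgroup.closure (S : Set H) = ⊤ := by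
  obtain ⟨S, hS⟩ := Group.FG.out (G := H)
  have : (d H) ∈ {n | ∃ S : Finset H, S.card = n ∧ Subgroup.closure (S : Set H) = ⊤} :=
    Nat.sInf_mem ⟨_, S, rfl, hS⟩
  exact this

theorem d_le {H : Type*} [Group H] (S : Finset H) (h : Subgroup.closure (S : Set H) = ⊤) :
    d H ≤ S.card := Nat.sInf_le ⟨S, rfl, h⟩

theorem d_le_of_surjective {H K : Type*} [Group H] [Group K] [Group.FG H] (f : H →* K)
    (hf : Function.Surjective f) : d K ≤ d H := by
  classical
  obtain ⟨S, hc, hS⟩ := d_spec (H := H)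
  rw [← hc]
  refine (d_le (S.image f) ?_).trans Finset.card_image_le
  rw [Finset.coe_image, ← MonoidHom.map_closure, hS, ← MonoidHom.range_eq_map]
  exact MonoidHom.range_eq_top.2 hf

theorem d_congr {H K : Type*} [Group H] [Group K] [Group.FG H] (e : H ≃* K) : d K = d H := by
  have : Group.FG K := Group.fg_of_surjective (f := e.toMonoidHom) e.surjective
  exact le_antisymm (d_le_of_surjective e.toMonoidHom e.surjective)
    (d_le_of_surjective e.symm.toMonoidHom e.symm.surjective)

theorem d_free_le (α : Type*) [Finite α] : d (FreeGroup α) ≤ Nat.card α := by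
  classical
  have := Fintype.ofFinite α
  refine (d_le (Finset.univ.image FreeGroup.of) ?_).trans ?_
  · simp [FreeGroup.closure_range_of]
  · rw [Nat.card_eq_fintype_card]; exact Finset.card_image_le

theorem finrank_HomQ_le_d {H : Type*} [Group H] [Group.FG H] :
    Module.finrank ℚ (HomQ H) ≤ d H := by
  obtain ⟨S, hc, hS⟩ := d_spec (H := H)
  let r : HomQ H →ₗ[ℚ] (S → ℚ) :=
    { toFun := fun f s => f.1 s, map_add' := fun _ _ => rfl, map_smul' := fun _ _ => rfl }
  have hr : Function.Injective r := by
    intro f g h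
    have : (HomQ.toHom f) = (HomQ.toHom g) := by
      apply MonoidHom.eq_of_eqOn_dense hS
      intro s hs
      exact congrFun h ⟨s, hs⟩
    apply Subtype.ext
    funext x
    exact DFunLike.congr_fun this x
  have := LinearMap.finrank_le_finrank_of_injective hr
  simpa [hc] using this

theorem d_free_group {H : Type*} [Group H] [IsFreeGroup H] [Module.Finite ℚ (HomQ H)] :
    Group.FG H ∧ d H = Module.finrank ℚ (HomQ H) := by
  let α := IsFreeGroup.Generators H
  let e : FreeGroup α ≃* H := IsFreeGroup.mulEquiv H
  let r : HomQ H →ₗ[ℚ] (α → ℚ) :=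
    { toFun := fun f s => f.1 (e (FreeGroup.of s)), map_add' := fun _ _ => rfl,
      map_smul' := fun _ _ => rfl }
  have hr : Function.Surjective r := by
    intro a
    let φ : H →* Multiplicative ℚ :=
      (FreeGroup.lift fun i => Multiplicative.ofAdd (a i)).comp e.symm.toMonoidHom
    refine ⟨⟨fun h => (φ h).toAdd, ?_⟩, ?_⟩
    · intro g h
      simp
    · funext i
      simp [r, φ]
  have : Module.Finite ℚ (α → ℚ) := Module.Finite.of_surjective r hr
  have hα : Finite α := by
    classical
    exact (Pi.linearIndependent_single_one α ℚ).finite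
  have := Fintype.ofFinite α
  have fg : Group.FG H := Group.fg_of_surjective (f := e.toMonoidHom) e.surjective
  refine ⟨fg, le_antisymm ?_ finrank_HomQ_le_d⟩
  rw [d_congr e]
  refine (d_free_le α).trans ?_
  have := LinearMap.finrank_le_finrank_of_surjective hr
  simpa using this

theorem rkQ_eq (H : Type*) [Group H] : rkQ H = Module.finrank ℚ (HomQ H) := by
  unfold rkQ
  rw [← Subspace.dual_finrank_eq]
  let A := Additive (Abelianization H)
  let r : Module.Dual ℚ (ℚ ⊗[ℤ] A) →ₗ[ℚ] HomQ H :=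
    { toFun := fun f => ⟨fun h => f (1 ⊗ₜ (Additive.ofMul (Abelianization.of h))), by
        intro g h
        simp [TensorProduct.tmul_add]⟩
      map_add' := fun _ _ => rfl
      map_smul' := fun _ _ => rfl }
  refine (LinearEquiv.ofBijective r ⟨?_, ?_⟩).finrank_eq
  · intro f g h
    apply TensorProduct.AlgebraTensorModule.curry_injective
    ext a
    obtain ⟨x, hx⟩ := QuotientGroup.mk_surjective (Additive.toMul a)
    have h3 : a = Additive.ofMul (Abelianization.of x) := hx.symm
    rw [h3]
    exact congrFun (congrArg Subtype.val h) x
  · intro f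
    let φ : A →ₗ[ℤ] ℚ :=
      (MonoidHom.toAdditiveLeft (Abelianization.lift (HomQ.toHom f))).toIntLinearMap
    refine ⟨TensorProduct.AlgebraTensorModule.lift
      ((LinearMap.toSpanSingleton ℚ _ φ)), ?_⟩
    apply Subtype.ext
    funext x
    simp [r, φ]
    rfl

theorem d_subgroup_free {m : ℕ} (V : Subgroup (FreeGroup (Fin m))) (hV : V.index ≠ 0) :
    Group.FG V ∧ d V + V.index = m * V.index + 1 := by
  have : Finite (FreeGroup (Fin m) ⧸ V) := Subgroup.index_ne_zero_iff_finite.1 hV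
  obtain ⟨h1, h2⟩ := CDer.free_finrank (MulAction.toPermHom (FreeGroup (Fin m)) (FreeGroup (Fin m) ⧸ V))
  obtain ⟨h3, h4⟩ := HomQ.finrank_index V
  obtain ⟨h5, h6⟩ := d_free_group (H := V)
  refine ⟨h5, ?_⟩
  rw [h6, h4, h2]
  rfl

namespace AmalgamatedProduct

variable {G₁ G₂ H : Type*} [Group G₁] [Group G₂] [Group H] (f₁ : H →* G₁) (f₂ : H →* G₂)

theorem comp_eq : (inl f₁ f₂).comp f₁ = (inr f₁ f₂).comp f₂ := by
  ext h
  apply QuotientGroup.eq.2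
  rw [← Subgroup.inv_mem_iff, mul_inv_rev, inv_inv]
  have hN : (Subgroup.normalClosure (Set.range fun h =>
    (Monoid.Coprod.inl (f₁ h) * (Monoid.Coprod.inr (f₂ h))⁻¹ : Monoid.Coprod G₁ G₂))).Normal :=
    inferInstance
  apply hN.mem_comm
  exact Subgroup.subset_normalClosure ⟨h, rfl⟩

/-- universal property -/
def lift {K : Type*} [Group K] (a : G₁ →* K) (b : G₂ →* K) (h : a.comp f₁ = b.comp f₂) :
    AmalgamatedProduct f₁ f₂ →* K :=
  QuotientGroup.lift _ (Monoid.Coprod.lift a b) (by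
    intro x hx
    refine (Subgroup.normalClosure_le_normal (N := (Monoid.Coprod.lift a b).ker) ?_) hx
    rintro _ ⟨y, rfl⟩
    have := DFunLike.congr_fun h y
    simp only [MonoidHom.comp_apply] at this
    simp [MonoidHom.mem_ker, this])

theorem lift_inl {K : Type*} [Group K] (a : G₁ →* K) (b : G₂ →* K) (h : a.comp f₁ = b.comp f₂) :
    (lift f₁ f₂ a b h).comp (inl f₁ f₂) = a := by
  ext x
  change Monoid.Coprod.lift a b (Monoid.Coprod.inl x) = _
  simp

theorem lift_inr {K : Type*} [Group K] (a : G₁ →* K) (b : G₂ →* K) (h : a.comp f₁ = b.comp f₂) :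
    (lift f₁ f₂ a b h).comp (inr f₁ f₂) = b := by
  ext x
  change Monoid.Coprod.lift a b (Monoid.Coprod.inr x) = _
  simp

theorem hom_ext' {K : Type*} [Group K] {a b : AmalgamatedProduct f₁ f₂ →* K}
    (h1 : a.comp (inl f₁ f₂) = b.comp (inl f₁ f₂))
    (h2 : a.comp (inr f₁ f₂) = b.comp (inr f₁ f₂)) : a = b := by
  apply QuotientGroup.monoidHom_ext
  apply Monoid.Coprod.hom_ext
  · exact h1
  · exact h2

theorem range_sup : (inl f₁ f₂).range ⊔ (inr f₁ f₂).range = ⊤ := by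
  let q : Monoid.Coprod G₁ G₂ →* AmalgamatedProduct f₁ f₂ := QuotientGroup.mk' _
  have hq : Function.Surjective q := QuotientGroup.mk'_surjective _
  change (q.comp Monoid.Coprod.inl).range ⊔ (q.comp Monoid.Coprod.inr).range = ⊤
  rw [MonoidHom.range_comp, MonoidHom.range_comp, ← Subgroup.map_sup,
    Monoid.Coprod.range_inl_sup_range_inr, ← MonoidHom.range_eq_map]
  exact MonoidHom.range_eq_top.2 hq

theorem d_le_add [Group.FG G₁] [Group.FG G₂] : d (AmalgamatedProduct f₁ f₂) ≤ d G₁ + d G₂ := by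
  classical
  obtain ⟨S, hc, hS⟩ := d_spec (H := G₁)
  obtain ⟨T, hc', hT⟩ := d_spec (H := G₂)
  rw [← hc, ← hc']
  refine (d_le (S.image (inl f₁ f₂) ∪ T.image (inr f₁ f₂)) ?_).trans
    ((Finset.card_union_le _ _).trans (add_le_add Finset.card_image_le Finset.card_image_le))
  rw [Finset.coe_union, Finset.coe_image, Finset.coe_image, Subgroup.closure_union,
    ← MonoidHom.map_closure, ← MonoidHom.map_closure, hS, hT, ← MonoidHom.range_eq_map,
    ← MonoidHom.range_eq_map, range_sup]

end AmalgamatedProduct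

/-- restriction of cocycles -/
def CDer.res {H K X : Type*} [Group H] [Group K] (ρ : H →* Equiv.Perm X) (f : K →* H) :
    CDer ρ →ₗ[ℚ] CDer (ρ.comp f) where
  toFun δ := ⟨fun g => δ.1 (f g), by
    intro g h x
    simp only [map_mul]
    exact (CDer.mul δ) _ _ _⟩
  map_add' _ _ := rfl
  map_smul' _ _ := rfl

theorem CDer.res_toTw {H K X : Type*} [Group H] [Group K] (ρ : H →* Equiv.Perm X) (f : K →* H)
    (δ : CDer ρ) : CDer.toTw (CDer.res ρ f δ) = (CDer.toTw δ).comp f := rfl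

theorem CDer.amalgam_finrank {m n : ℕ} (f₁ : Multiplicative ℤ →* FreeGroup (Fin m))
    (f₂ : Multiplicative ℤ →* FreeGroup (Fin n)) {X : Type*} [Finite X]
    (ρ : AmalgamatedProduct f₁ f₂ →* Equiv.Perm X) :
    Module.Finite ℚ (CDer ρ) ∧
      m * Nat.card X + n * Nat.card X ≤ Module.finrank ℚ (CDer ρ) + Nat.card X := by
  have := Fintype.ofFinite X
  let i₁ := AmalgamatedProduct.inl f₁ f₂
  let i₂ := AmalgamatedProduct.inr f₁ f₂
  obtain ⟨fin1, e1⟩ := CDer.free_finrank (ρ.comp i₁)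
  obtain ⟨fin2, e2⟩ := CDer.free_finrank (ρ.comp i₂)
  let R : CDer ρ →ₗ[ℚ] CDer (ρ.comp i₁) × CDer (ρ.comp i₂) :=
    (CDer.res ρ i₁).prod (CDer.res ρ i₂)
  have hR : Function.Injective R := by
    intro δ ε h
    apply CDer.ext_tw
    have h1 := congrArg CDer.toTw (congrArg Prod.fst h)
    have h2 := congrArg CDer.toTw (congrArg Prod.snd h)
    exact AmalgamatedProduct.hom_ext' f₁ f₂ h1 h2
  have finR : Module.Finite ℚ (CDer ρ) := Module.Finite.of_injective R hR
  refine ⟨finR, ?_⟩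
  let c : Multiplicative ℤ := Multiplicative.ofAdd 1
  let L : CDer (ρ.comp i₁) × CDer (ρ.comp i₂) →ₗ[ℚ] (X → ℚ) :=
    { toFun := fun q => q.1.1 (f₁ c) - q.2.1 (f₂ c)
      map_add' := by
        intro a b; funext x; simp; ring
      map_smul' := by
        intro a b; funext x; simp; ring }
  have hker : LinearMap.ker L ≤ LinearMap.range R := by
    rintro ⟨δ, ε⟩ h
    have h0 : δ.1 (f₁ c) = ε.1 (f₂ c) := sub_eq_zero.1 (LinearMap.mem_ker.1 h)
    have hc : (CDer.toTw δ).comp f₁ = (CDer.toTw ε).comp f₂ := by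
      apply MonoidHom.ext_mint
      change (⟨Multiplicative.ofAdd (δ.1 (f₁ c)), ρ (i₁ (f₁ c))⟩ : Tw X) =
        ⟨Multiplicative.ofAdd (ε.1 (f₂ c)), ρ (i₂ (f₂ c))⟩
      have := DFunLike.congr_fun (AmalgamatedProduct.comp_eq f₁ f₂) c
      rw [h0, show i₁ (f₁ c) = i₂ (f₂ c) from this]
    let Ψ := AmalgamatedProduct.lift f₁ f₂ (CDer.toTw δ) (CDer.toTw ε) hc
    have hl : Ψ.comp i₁ = (CDer.toTw δ) := AmalgamatedProduct.lift_inl f₁ f₂ _ _ hc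
    have hr : Ψ.comp i₂ = (CDer.toTw ε) := AmalgamatedProduct.lift_inr f₁ f₂ _ _ hc
    refine ⟨CDer.ofTw Ψ ?_, ?_⟩
    · apply AmalgamatedProduct.hom_ext'
      · change SemidirectProduct.rightHom.comp (Ψ.comp i₁) = _
        rw [hl]; rfl
      · change SemidirectProduct.rightHom.comp (Ψ.comp i₂) = _
        rw [hr]; rfl
    · apply Prod.ext
      · apply Subtype.ext
        funext g
        exact congrArg (fun t : Tw X => t.left.toAdd) (DFunLike.congr_fun hl g)
      · apply Subtype.ext
        funext g
        exact congrArg (fun t : Tw X => t.left.toAdd) (DFunLike.congr_fun hr g)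
  have a1 := LinearMap.finrank_range_add_finrank_ker L
  have a2 := Submodule.finrank_mono hker
  rw [LinearMap.finrank_range_of_inj hR] at a2
  have a3 := Submodule.finrank_le (LinearMap.range L)
  rw [Module.finrank_prod, e1, e2] at a1
  rw [Module.finrank_fintype_fun_eq_card, ← Nat.card_eq_fintype_card] at a3
  omega

theorem amalgam_inj {m n : ℕ} (f₁ : Multiplicative ℤ →* FreeGroup (Fin m))
    (f₂ : Multiplicative ℤ →* FreeGroup (Fin n))
    (hf₁ : Function.Injective f₁) (hf₂ : Function.Injective f₂) :
    Function.Injective (AmalgamatedProduct.inl f₁ f₂) ∧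
    Function.Injective (AmalgamatedProduct.inr f₁ f₂) := by
  let Fm : Bool → Type := fun i => FreeGroup (Fin (cond i m n))
  let inst : ∀ i, Group (Fm i) := fun i => inferInstanceAs (Group (FreeGroup _))
  let φ : ∀ i, Multiplicative ℤ →* Fm i := fun i =>
    match i with
    | true => f₁
    | false => f₂
  have hφ : ∀ i, Function.Injective (φ i) := by
    intro i
    cases i
    · exact hf₂
    · exact hf₁
  let a : FreeGroup (Fin m) →* Monoid.PushoutI φ := Monoid.PushoutI.of (φ := φ) true
  let b : FreeGroup (Fin n) →* Monoid.PushoutI φ := Monoid.PushoutI.of (φ := φ) false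
  have ha : Function.Injective a := Monoid.PushoutI.of_injective hφ true
  have hb : Function.Injective b := Monoid.PushoutI.of_injective hφ false
  have hab : a.comp f₁ = b.comp f₂ :=
    (Monoid.PushoutI.of_comp_eq_base (φ := φ) true).trans
      (Monoid.PushoutI.of_comp_eq_base (φ := φ) false).symm
  constructor
  · have h := AmalgamatedProduct.lift_inl f₁ f₂ a b hab
    apply Function.Injective.of_comp (f := AmalgamatedProduct.lift f₁ f₂ a b hab)
    rw [← MonoidHom.coe_comp, h]
    exact ha
  · have h := AmalgamatedProduct.lift_inr f₁ f₂ a b hab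
    apply Function.Injective.of_comp (f := AmalgamatedProduct.lift f₁ f₂ a b hab)
    rw [← MonoidHom.coe_comp, h]
    exact hb

theorem d_inf_range {m : ℕ} {G : Type*} [Group G] (U : Subgroup G) [U.Normal]
    (hU : U.index ≠ 0) (i : FreeGroup (Fin m) →* G) (hi : Function.Injective i)
    (h : U ⊔ i.range = ⊤) : d ↥(U ⊓ i.range) + U.index = m * U.index + 1 := by
  have hidx : (U.comap i).index = U.index := by
    rw [Subgroup.index_comap, ← Subgroup.relIndex_sup_left, h, Subgroup.relIndex_top_right]
  obtain ⟨fg, hd⟩ := d_subgroup_free (U.comap i) (by rwa [hidx])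
  have e1 : (U.comap i) ≃* ((U.comap i).map i) := Subgroup.equivMapOfInjective _ i hi
  have e2 : (U.comap i).map i = U ⊓ i.range := by
    rw [Subgroup.map_comap_eq, inf_comm]
  rw [← e2, d_congr e1, ← hidx, hd]

end RkQHelpers

theorem rkQ_bound_amalgam_free_factors (m n p : ℕ) (hm : 2 ≤ m) (hn : 2 ≤ n)
    (hp : p.Prime)
    (f₁ : Multiplicative ℤ →* FreeGroup (Fin m))
    (f₂ : Multiplicative ℤ →* FreeGroup (Fin n))
    (hf₁ : Function.Injective f₁) (hf₂ : Function.Injective f₂)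
    (U : Subgroup (AmalgamatedProduct f₁ f₂)) [U.Normal] (hU : U.index = p)
    (h1 : U ⊔ (AmalgamatedProduct.inl f₁ f₂).range = ⊤)
    (h2 : U ⊔ (AmalgamatedProduct.inr f₁ f₂).range = ⊤)
    (hC : (U.subgroupOf ((AmalgamatedProduct.inl f₁ f₂).comp f₁).range).index = p) :
    d ↥(U ⊓ (AmalgamatedProduct.inl f₁ f₂).range) +
        d ↥(U ⊓ (AmalgamatedProduct.inr f₁ f₂).range) - 1 ≤ rkQ ↥U ∧
      d (FreeGroup (Fin m)) + d (FreeGroup (Fin n)) + 1 ≤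
        d ↥(U ⊓ (AmalgamatedProduct.inl f₁ f₂).range) +
          d ↥(U ⊓ (AmalgamatedProduct.inr f₁ f₂).range) - 1 ∧
      d (AmalgamatedProduct f₁ f₂) <
        d (FreeGroup (Fin m)) + d (FreeGroup (Fin n)) + 1 := by
  have hp2 := hp.two_le
  have hU0 : U.index ≠ 0 := by omega
  have : Finite (AmalgamatedProduct f₁ f₂ ⧸ U) := Subgroup.index_ne_zero_iff_finite.1 hU0
  obtain ⟨i1, i2⟩ := amalgam_inj f₁ f₂ hf₁ hf₂
  have d1 := d_inf_range U hU0 _ i1 h1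
  have d2 := d_inf_range U hU0 _ i2 h2
  obtain ⟨fin, a1⟩ := CDer.amalgam_finrank f₁ f₂
    (MulAction.toPermHom (AmalgamatedProduct f₁ f₂) (AmalgamatedProduct f₁ f₂ ⧸ U))
  obtain ⟨_, a2⟩ := HomQ.finrank_index U
  rw [← rkQ_eq] at a2
  have b1 := d_free_le (Fin m)
  have b2 := d_free_le (Fin n)
  have b3 := AmalgamatedProduct.d_le_add f₁ f₂
  rw [Nat.card_fin] at b1 b2
  have hcard : Nat.card (AmalgamatedProduct f₁ f₂ ⧸ U) = p := hU
  rw [hcard] at a1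
  rw [hU] at d1 d2 a2
  have c1 : 2 * m + p ≤ m * p + 2 := by nlinarith
  have c2 : 2 * n + p ≤ n * p + 2 := by nlinarith
  refine ⟨?_, ?_, ?_⟩ <;> omega
end
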